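/- Let F be a real-analytic function on a connected open set U ⊆ ℝ^d, let D ⊆ U be compact, and let L be an admissible differential operator of type (α,β) with (α,β) ≠ (1,(0,…,0)). For i = 1,…,d define p_i by 1/p_i = 1 − β_i/(|β|+1−α) (one has 0 ≤ β_i ≤ |β|+1−α, and L^{∞,1} is interpreted as L^∞). Then there exists a finite constant C such that for every c > 0 with |LF(x)| ≥ c for all x ∈ D, every ε > 0, and all measurable functions f_1,…,f_d : ℝ → ℝ, |∫_D χ_{{|F(x)| ≤ ε}} · f_1(x_1)⋯f_d(x_d) dx| ≤ C · ε^{α/(|β|+1−α)} · c^{−1/(|β|+1−α)} · Π_{i=1}^d ‖f_i‖_{L^{p_i,1}(ℝ)}. -/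

import Mathlib

open MeasureTheory
open scoped ENNReal

/-- The partial derivative `∂/∂x_i` of a scalar function on `ℝ^d`. -/
noncomputable def pderiv' {d : ℕ} (i : Fin d) (f : (Fin d → ℝ) → ℝ) : (Fin d → ℝ) → ℝ :=
  fun x => fderiv ℝ f x (Pi.single i 1)

/-- The classes `𝓛^{α,β}` of admissible differential operators of type `(α,β)`:
`𝓛^{1,0}` contains exactly the identity, and `L ∈ 𝓛^{α,β}` when there are distinct indices
`i_1,…,i_n` and operators `L_k ∈ 𝓛^{α_k,β_k}` with `α = Σ α_k`,
`β = Σ β_k + e_{i_1} + ⋯ + e_{i_n}` and `L F = det [∂_{x_{i_r}} (L_k F)]` for all smooth `F`. -/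
inductive IsAdmissible (d : ℕ) :
    ℕ → (Fin d → ℕ) → (((Fin d → ℝ) → ℝ) → (Fin d → ℝ) → ℝ) → Prop
  | id : IsAdmissible d 1 0 (fun F => F)
  | det (n : ℕ) (hn : 1 ≤ n) (hnd : n ≤ d) (i : Fin n → Fin d)
      (hi : Function.Injective i) (αs : Fin n → ℕ) (βs : Fin n → Fin d → ℕ)
      (Ls : Fin n → ((Fin d → ℝ) → ℝ) → (Fin d → ℝ) → ℝ)
      (hLs : ∀ k, IsAdmissible d (αs k) (βs k) (Ls k))
      (L : ((Fin d → ℝ) → ℝ) → (Fin d → ℝ) → ℝ)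
      (hL : ∀ F : (Fin d → ℝ) → ℝ, ∀ x, ContDiffAt ℝ (⊤ : ℕ∞) F x →
        L F x = (Matrix.of fun r k : Fin n => pderiv' (i r) (Ls k F) x).det) :
      IsAdmissible d (∑ k, αs k) ((∑ k, βs k) + ∑ k, Pi.single (i k) 1) L

/-- The Lorentz `L^{p,1}(ℝ)` norm, parametrized by the reciprocal exponent `ρ = 1/p`:
for `0 < ρ ≤ 1` it is `∫_0^∞ |{t : |f t| > s}|^ρ ds`, and for `ρ = 0` (`p = ∞`) it is
the essential supremum of `|f|`. -/
noncomputable def lorentzNorm₁ (ρ : ℝ) (f : ℝ → ℝ) : ℝ≥0∞ :=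
  if ρ = 0 then eLpNorm f ⊤ volume
  else ∫⁻ s in Set.Ioi (0 : ℝ), (volume {t : ℝ | s < |f t|}) ^ ρ

namespace SublevelEstimate

open Filter Topology

/-- The monomial `x ^ γ`. -/
def mon {d : ℕ} (x : Fin d → ℝ) (γ : Fin d → ℕ) : ℝ := ∏ i, x i ^ γ i

section mon
variable {d : ℕ}

lemma mon_add (x : Fin d → ℝ) (γ δ : Fin d → ℕ) : mon x (γ + δ) = mon x γ * mon x δ := by
  simp [mon, pow_add, Finset.prod_mul_distrib]

lemma mon_zero (x : Fin d → ℝ) : mon x 0 = 1 := by simp [mon]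

lemma mon_pos {r : Fin d → ℝ} (hr : ∀ i, 0 < r i) (γ : Fin d → ℕ) : 0 < mon r γ :=
  Finset.prod_pos fun i _ => pow_pos (hr i) _

lemma abs_mon_le {x r : Fin d → ℝ} (h : ∀ i, |x i| ≤ r i) (γ : Fin d → ℕ) :
    |mon x γ| ≤ mon r γ := by
  unfold mon
  rw [Finset.abs_prod]
  refine Finset.prod_le_prod (fun _ _ => abs_nonneg _) fun i _ => ?_
  rw [abs_pow]
  exact pow_le_pow_left₀ (abs_nonneg _) (h i) _

lemma mon_mono {r s : Fin d → ℝ} (hr : ∀ i, 0 ≤ r i) (h : ∀ i, r i ≤ s i) (γ : Fin d → ℕ) :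
    mon r γ ≤ mon s γ :=
  Finset.prod_le_prod (fun i _ => pow_nonneg (hr i) _) fun i _ => pow_le_pow_left₀ (hr i) (h i) _

end mon

/-- `PSWith r c f`: the power series with coefficients `c` converges absolutely on the closed
polydisc of polyradius `r`, with sum `f`. -/
def PSWith {d : ℕ} (r : Fin d → ℝ) (c : (Fin d → ℕ) → ℝ) (f : (Fin d → ℝ) → ℝ) : Prop :=
  (Summable fun γ => |c γ| * mon r γ) ∧
    ∀ x, (∀ i, |x i| ≤ r i) → HasSum (fun γ => c γ * mon x γ) (f x)

/-- `f` is given on the closed polydisc of polyradius `r` by an absolutely convergent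
power series. -/
def PS {d : ℕ} (r : Fin d → ℝ) (f : (Fin d → ℝ) → ℝ) : Prop := ∃ c, PSWith r c f

section PS
variable {d : ℕ} {r : Fin d → ℝ} {f g : (Fin d → ℝ) → ℝ}

lemma summable_of_polydisc {K : Type*} {c : K → ℝ} {e : K → Fin d → ℕ}
    (hs : Summable fun k => |c k| * mon r (e k)) {x : Fin d → ℝ} (hx : ∀ i, |x i| ≤ r i) :
    Summable fun k => c k * mon x (e k) := by
  refine Summable.of_norm_bounded hs fun k => ?_
  rw [Real.norm_eq_abs, abs_mul]
  exact mul_le_mul_of_nonneg_left (abs_mon_le hx _) (abs_nonneg _)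

lemma PS.of_family (hr : ∀ i, 0 < r i) {K : Type*} (c : K → ℝ) (e : K → Fin d → ℕ)
    (hs : Summable fun k => |c k| * mon r (e k))
    (hf : ∀ x, (∀ i, |x i| ≤ r i) → HasSum (fun k => c k * mon x (e k)) (f x)) : PS r f := by
  have hfib : ∀ γ, Summable fun k : {k // e k = γ} => |c k| := by
    intro γ
    have := hs.comp_injective (i := fun k : {k // e k = γ} => k.1) Subtype.val_injective
    have h2 : (fun k : {k // e k = γ} => |c k|)
        = fun k : {k // e k = γ} => (|c k| * mon r (e k)) * (mon r γ)⁻¹ := by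
      funext k
      rw [k.2, mul_assoc, mul_inv_cancel₀ (mon_pos hr γ).ne', mul_one]
    rw [h2]
    exact this.mul_right _
  refine ⟨fun γ => ∑' k : {k // e k = γ}, c k, ?_, ?_⟩
  · have h1 := (Equiv.sigmaFiberEquiv e).summable_iff.mpr hs
    have h2 := ((summable_sigma_of_nonneg fun x =>
      mul_nonneg (abs_nonneg _) (mon_pos hr _).le).1 h1).2
    refine Summable.of_nonneg_of_le (fun γ => mul_nonneg (abs_nonneg _) (mon_pos hr _).le)
      (fun γ => ?_) h2
    have h3 : ∀ k : {k // e k = γ}, ((fun k => |c k| * mon r (e k)) ∘ (Equiv.sigmaFiberEquiv e))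
        ⟨γ, k⟩ = |c k| * mon r γ := by
      intro k; simp [Equiv.sigmaFiberEquiv, k.2]
    refine le_of_le_of_eq ?_ (tsum_congr h3).symm
    rw [tsum_mul_right]
    refine mul_le_mul_of_nonneg_right ?_ (mon_pos hr _).le
    have := norm_tsum_le_tsum_norm (f := fun k : {k // e k = γ} => c k) (hfib γ)
    simpa [Real.norm_eq_abs] using this
  · intro x hx
    have h1 := (Equiv.sigmaFiberEquiv e).hasSum_iff.mpr (hf x hx)
    refine h1.sigma fun γ => ?_
    have h3 : (fun k : {k // e k = γ} => ((fun k => c k * mon x (e k)) ∘ (Equiv.sigmaFiberEquiv e))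
        ⟨γ, k⟩) = fun k : {k // e k = γ} => c k * mon x γ := by
      funext k; simp [Equiv.sigmaFiberEquiv, k.2]
    rw [h3]
    exact ((hfib γ).of_abs.hasSum).mul_right _

lemma PSWith.mono {c : (Fin d → ℕ) → ℝ} {s : Fin d → ℝ} (hf : PSWith r c f)
    (hs : ∀ i, 0 ≤ s i) (h : ∀ i, s i ≤ r i) : PSWith s c f :=
  ⟨Summable.of_nonneg_of_le (fun _ => mul_nonneg (abs_nonneg _)
      (Finset.prod_nonneg fun i _ => pow_nonneg (hs i) _))
    (fun γ => mul_le_mul_of_nonneg_left (mon_mono hs h γ) (abs_nonneg _)) hf.1,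
   fun x hx => hf.2 x fun i => (hx i).trans (h i)⟩

lemma PS.mono {s : Fin d → ℝ} (hf : PS r f) (hs : ∀ i, 0 ≤ s i) (h : ∀ i, s i ≤ r i) : PS s f := by
  obtain ⟨c, hc⟩ := hf
  exact ⟨c, hc.mono hs h⟩

lemma PSWith.sub {c c' : (Fin d → ℕ) → ℝ} (hr : ∀ i, 0 < r i) (hf : PSWith r c f)
    (hg : PSWith r c' g) : PSWith r (c - c') (f - g) := by
  refine ⟨?_, fun x hx => ?_⟩
  · refine Summable.of_nonneg_of_le (fun γ => mul_nonneg (abs_nonneg _) (mon_pos hr _).le)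
      (fun _ => ?_) (hf.1.add hg.1)
    rw [← add_mul]
    exact mul_le_mul_of_nonneg_right (abs_sub _ _) (mon_pos hr _).le
  · simpa [sub_mul] using (hf.2 x hx).sub (hg.2 x hx)

lemma PSWith.const_mul {c : (Fin d → ℕ) → ℝ} (hf : PSWith r c f) (a : ℝ) :
    PSWith r (fun γ => a * c γ) (fun x => a * f x) := by
  refine ⟨?_, fun x hx => ?_⟩
  · simpa [abs_mul, mul_assoc] using hf.1.mul_left |a|
  · simpa [mul_assoc] using (hf.2 x hx).mul_left a

lemma PS.sub (hr : ∀ i, 0 < r i) (hf : PS r f) (hg : PS r g) : PS r (f - g) := by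
  obtain ⟨c, hc⟩ := hf
  obtain ⟨c', hc'⟩ := hg
  exact ⟨_, hc.sub hr hc'⟩

lemma PS.const (hr : ∀ i, 0 < r i) (a : ℝ) : PS r (fun _ => a) := by
  refine PS.of_family hr (K := Unit) (fun _ => a) (fun _ => 0) Summable.of_finite fun x _ => ?_
  simp [mon_zero]

lemma PS.neg (hr : ∀ i, 0 < r i) (hf : PS r f) : PS r (-f) := by
  have := (PS.const hr 0).sub hr hf
  convert this using 1
  funext x; simp

lemma PS.add (hr : ∀ i, 0 < r i) (hf : PS r f) (hg : PS r g) : PS r (f + g) := by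
  simpa using hf.sub hr (hg.neg hr)

lemma PS.mul (hr : ∀ i, 0 < r i) (hf : PS r f) (hg : PS r g) : PS r (f * g) := by
  obtain ⟨c, hc, hc2⟩ := hf
  obtain ⟨c', hc', hc2'⟩ := hg
  refine PS.of_family hr (K := (Fin d → ℕ) × (Fin d → ℕ)) (fun k => c k.1 * c' k.2)
    (fun k => k.1 + k.2) ?_ fun x hx => ?_
  · have h3 : (fun k : (Fin d → ℕ) × (Fin d → ℕ) => |c k.1 * c' k.2| * mon r (k.1 + k.2)) =
        fun k => |c k.1| * mon r k.1 * (|c' k.2| * mon r k.2) := by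
      funext k; rw [abs_mul, mon_add]; ring
    rw [h3]
    have h0 : ∀ b : (Fin d → ℕ) → ℝ, 0 ≤ fun γ => |b γ| * mon r γ :=
      fun b γ => mul_nonneg (abs_nonneg (b γ)) (mon_pos hr γ).le
    exact Summable.mul_of_nonneg (f := fun γ => |c γ| * mon r γ) (g := fun γ => |c' γ| * mon r γ)
      hc hc' (h0 c) (h0 c')
  · have h1 := summable_of_polydisc hc hx
    have h2 := summable_of_polydisc hc' hx
    have h12 : Summable fun k : (Fin d → ℕ) × (Fin d → ℕ) =>
        (c k.1 * mon x k.1) * (c' k.2 * mon x k.2) :=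
      summable_mul_of_summable_norm (f := fun γ => c γ * mon x γ) (g := fun γ => c' γ * mon x γ)
        h1.norm h2.norm
    have h4 : HasSum (fun k : (Fin d → ℕ) × (Fin d → ℕ) =>
        (c k.1 * mon x k.1) * (c' k.2 * mon x k.2)) (f x * g x) :=
      HasSum.mul (f := fun γ => c γ * mon x γ) (g := fun γ => c' γ * mon x γ)
        (hc2 x hx) (hc2' x hx) h12
    have h3 : (fun k : (Fin d → ℕ) × (Fin d → ℕ) => c k.1 * c' k.2 * mon x (k.1 + k.2)) =
        fun k => c k.1 * mon x k.1 * (c' k.2 * mon x k.2) := by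
      funext k; rw [mon_add]; ring
    rw [h3]
    exact h4

lemma PS.sum (hr : ∀ i, 0 < r i) {ι : Type*} (s : Finset ι) {F : ι → (Fin d → ℝ) → ℝ}
    (h : ∀ i ∈ s, PS r (F i)) : PS r (∑ i ∈ s, F i) :=
  Finset.sum_induction F (PS r) (fun _ _ h1 h2 => h1.add hr h2) (PS.const hr 0) h

lemma PS.prod (hr : ∀ i, 0 < r i) {ι : Type*} (s : Finset ι) {F : ι → (Fin d → ℝ) → ℝ}
    (h : ∀ i ∈ s, PS r (F i)) : PS r (∏ i ∈ s, F i) :=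
  Finset.prod_induction F (PS r) (fun _ _ h1 h2 => h1.mul hr h2) (PS.const hr 1) h

lemma PS.continuousOn (hf : PS r f) : ContinuousOn f {x | ∀ i, |x i| ≤ r i} := by
  obtain ⟨c, hc, hc2⟩ := hf
  have : ContinuousOn (fun x => ∑' γ, c γ * mon x γ) {x | ∀ i, |x i| ≤ r i} := by
    refine continuousOn_tsum (fun γ => ?_) hc fun γ x hx => ?_
    · unfold mon; fun_prop
    · rw [Real.norm_eq_abs, abs_mul]
      exact mul_le_mul_of_nonneg_left (abs_mon_le hx _) (abs_nonneg _)
  exact this.congr fun x hx => (hc2 x hx).tsum_eq.symm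

lemma PS.exists_of_analyticAt (hf : AnalyticAt ℝ f 0) :
    ∃ ρ > 0, PS (fun _ => ρ) f := by
  obtain ⟨p, R, hp⟩ := hf
  obtain ⟨ρ, hρ0, hρ⟩ : ∃ ρ : ℝ, 0 < ρ ∧ ENNReal.ofReal (d * ρ) < R ∧ ENNReal.ofReal ρ < R := by
    obtain ⟨a, ha0, ha⟩ := ENNReal.lt_iff_exists_nnreal_btwn.1 hp.r_pos
    have ha0' : 0 < (a : ℝ) := by exact_mod_cast ha0
    refine ⟨a / (d + 1), by positivity, ?_, ?_⟩
    all_goals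
      refine lt_of_le_of_lt (ENNReal.ofReal_le_of_le_toReal (b := (a : ENNReal)) ?_) ha
      simp only [ENNReal.coe_toReal]
    · rw [mul_div_assoc', div_le_iff₀ (by positivity)]; nlinarith
    · rw [div_le_iff₀ (by positivity)]; nlinarith [Nat.cast_nonneg (α := ℝ) d]
  refine ⟨ρ, hρ0, ?_⟩
  let e : (Σ n : ℕ, (Fin n → Fin d)) → Fin d → ℕ :=
    fun k i => (Finset.univ.filter fun j => k.2 j = i).card
  let c : (Σ n : ℕ, (Fin n → Fin d)) → ℝ := fun k => p k.1 fun j => Pi.single (k.2 j) 1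
  have hmon : ∀ (x : Fin d → ℝ) k, mon x (e k) = ∏ j, x (k.2 j) := by
    intro x k
    rw [← Finset.prod_fiberwise Finset.univ k.2]
    refine Finset.prod_congr rfl fun i _ => ?_
    rw [Finset.prod_congr rfl (g := fun _ => x i)]
    · simp [e]
    · intro j hj; rw [(Finset.mem_filter.1 hj).2]
  have hc : ∀ k, |c k| ≤ ‖p k.1‖ := by
    intro k
    refine ((p k.1).le_opNorm _).trans ?_
    refine mul_le_of_le_one_right (norm_nonneg _) ?_
    refine Finset.prod_le_one (fun _ _ => norm_nonneg _) fun j _ => ?_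
    rw [Pi.norm_single]; simp
  have hexp : ∀ (x : Fin d → ℝ) n, p n (fun _ => x) = ∑ w : Fin n → Fin d, c ⟨n, w⟩ * mon x (e ⟨n, w⟩) := by
    intro x n
    have hx : x = ∑ i, x i • (Pi.single i (1:ℝ) : Fin d → ℝ) := by
      funext j; simp [Finset.sum_apply, Pi.single_apply]
    have : p n (fun _ => x) = p n (fun _ => ∑ i, x i • (Pi.single i (1:ℝ) : Fin d → ℝ)) := by
      rw [← hx]
    rw [this, ContinuousMultilinearMap.map_sum]
    refine Finset.sum_congr rfl fun w _ => ?_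
    rw [ContinuousMultilinearMap.map_smul_univ, hmon, smul_eq_mul, mul_comm]
  have hsum : Summable fun k => |c k| * mon (fun _ : Fin d => ρ) (e k) := by
    rw [summable_sigma_of_nonneg fun k => mul_nonneg (abs_nonneg _) (mon_pos (fun _ => hρ0) _).le]
    refine ⟨fun n => Summable.of_finite, ?_⟩
    have h0 : Summable fun n => ‖p n‖ * ((Real.toNNReal (d * ρ) : ℝ)) ^ n :=
      p.summable_norm_mul_pow (lt_of_lt_of_le hρ.1 hp.r_le)
    refine Summable.of_nonneg_of_le (fun n => tsum_nonneg fun w =>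
      mul_nonneg (abs_nonneg _) (mon_pos (fun _ => hρ0) _).le) (fun n => ?_) h0
    rw [tsum_fintype]
    calc ∑ w : Fin n → Fin d, |c ⟨n, w⟩| * mon (fun _ : Fin d => ρ) (e ⟨n, w⟩)
        ≤ ∑ w : Fin n → Fin d, ‖p n‖ * ρ ^ n := by
          refine Finset.sum_le_sum fun w _ => ?_
          rw [hmon]
          simp only [Finset.prod_const, Finset.card_univ, Fintype.card_fin]
          exact mul_le_mul_of_nonneg_right (hc ⟨n, w⟩) (pow_nonneg hρ0.le _)
      _ = _ := by
          rw [Finset.sum_const, Finset.card_univ, Fintype.card_fun, Fintype.card_fin,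
            Fintype.card_fin, Real.coe_toNNReal _ (by positivity), nsmul_eq_mul, mul_pow]
          push_cast; ring
  refine PS.of_family (fun _ => hρ0) c e hsum fun x hx => ?_
  have hxR : x ∈ Metric.eball (0 : Fin d → ℝ) R := by
    rw [Metric.mem_eball, edist_zero_right]
    refine lt_of_le_of_lt ?_ hρ.2
    rw [← ofReal_norm]
    refine ENNReal.ofReal_le_ofReal ((pi_norm_le_iff_of_nonneg hρ0.le).2 hx)
  have h1 := hp.hasSum hxR
  rw [zero_add] at h1
  have h2 := (summable_of_polydisc hsum hx).hasSum
  have h3 := h2.sigma fun n => hasSum_fintype _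
  have h4 : (fun n => ∑ w : Fin n → Fin d, c ⟨n, w⟩ * mon x (e ⟨n, w⟩)) = fun n => p n fun _ => x := by
    funext n; rw [hexp]
  rw [h4] at h3
  rw [← h3.unique h1]
  exact h2

end PS

lemma prod_ite_lt_eq {d : ℕ} (j : Fin d) (u v w : Fin d → ℝ) :
    ∏ i, (if i < j then u i else if i = j then v i else w i) =
      (∏ i with i < j, u i) * v j * ∏ i with j < i, w i := by
  rw [Finset.prod_ite, Finset.prod_ite, ← mul_assoc]
  congr 1
  · congr 1
    rw [Finset.filter_filter, show Finset.univ.filter (fun i => ¬ i < j ∧ i = j) = {j} by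
      ext i; simp only [Finset.mem_filter, Finset.mem_univ, true_and, Finset.mem_singleton]
      exact ⟨fun h => h.2, fun h => ⟨h ▸ lt_irrefl _, h⟩⟩, Finset.prod_singleton]
  · rw [Finset.filter_filter]
    refine Finset.prod_congr ?_ fun _ _ => rfl
    ext i; simp only [Finset.mem_filter, Finset.mem_univ, true_and]
    constructor
    · rintro ⟨h1, h2⟩; exact lt_of_le_of_ne (not_lt.1 h1) (Ne.symm h2)
    · intro h; exact ⟨not_lt.2 h.le, h.ne'⟩

lemma mon_eq_split {d : ℕ} (j : Fin d) (x : Fin d → ℝ) (γ : Fin d → ℕ) :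
    mon x γ = (∏ i with i < j, x i ^ γ i) * x j ^ γ j * ∏ i with j < i, x i ^ γ i := by
  rw [← prod_ite_lt_eq j (fun i => x i ^ γ i) (fun i => x i ^ γ i) (fun i => x i ^ γ i)]
  simp [mon]

lemma mon_sub_mon {d : ℕ} (x z : Fin d → ℝ) (γ : Fin d → ℕ) :
    mon x γ - mon z γ = ∑ j, (x j - z j) * ((∏ i with i < j, z i ^ γ i) *
      (∑ k ∈ Finset.range (γ j), x j ^ k * z j ^ (γ j - 1 - k)) * ∏ i with j < i, x i ^ γ i) := by
  have := Finset.prod_sub_ordered Finset.univ (fun i => x i ^ γ i) (fun i => x i ^ γ i - z i ^ γ i)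
  simp only [sub_sub_cancel] at this
  unfold mon
  rw [this, sub_sub_cancel]
  refine Finset.sum_congr rfl fun j _ => ?_
  rw [← geom_sum₂_mul]
  ring

lemma PS.hadamard {d : ℕ} {r : Fin d → ℝ} (hr : ∀ i, 0 < r i) {g : (Fin d → ℝ) → ℝ}
    (hg : PS (fun i => 2 * r i) g) {z : Fin d → ℝ} (hz : ∀ i, |z i| ≤ r i) :
    ∃ a : Fin d → (Fin d → ℝ) → ℝ, (∀ j, PS r (a j)) ∧
      ∀ x, (∀ i, |x i| ≤ r i) → g x - g z = ∑ j, (x j - z j) * a j x := by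
  obtain ⟨c, hc, hc2⟩ := hg
  let coef : (j : Fin d) → (Σ γ : Fin d → ℕ, Fin (γ j)) → ℝ := fun j k =>
    c k.1 * ((∏ i with i < j, z i ^ k.1 i) * z j ^ (k.1 j - 1 - k.2))
  let e : (j : Fin d) → (Σ γ : Fin d → ℕ, Fin (γ j)) → Fin d → ℕ := fun j k i =>
    if i < j then 0 else if i = j then k.2 else k.1 i
  have hmon : ∀ (x : Fin d → ℝ) j k, mon x (e j k) = x j ^ (k.2 : ℕ) * ∏ i with j < i, x i ^ k.1 i := by
    intro x j k
    have := prod_ite_lt_eq j (fun _ => 1) (fun i => x i ^ (k.2 : ℕ)) (fun i => x i ^ k.1 i)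
    rw [Finset.prod_const_one, one_mul] at this
    rw [← this, mon]
    refine Finset.prod_congr rfl fun i _ => ?_
    simp only [e]
    split_ifs <;> simp
  have hsum : ∀ j, Summable fun k => |coef j k| * mon r (e j k) := by
    intro j
    rw [summable_sigma_of_nonneg fun k => mul_nonneg (abs_nonneg _) (mon_pos hr _).le]
    refine ⟨fun n => Summable.of_finite, ?_⟩
    refine Summable.of_nonneg_of_le (fun γ => tsum_nonneg fun k =>
      mul_nonneg (abs_nonneg _) (mon_pos hr _).le) (fun γ => ?_) (hc.mul_right (r j)⁻¹)
    rw [tsum_fintype]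
    have h1 : ∀ k : Fin (γ j), |coef j ⟨γ, k⟩| * mon r (e j ⟨γ, k⟩) ≤
        |c γ| * mon r γ * (r j)⁻¹ := by
      intro k
      rw [hmon, mon_eq_split j r γ]
      simp only [coef]
      rw [abs_mul, abs_mul, Finset.abs_prod, abs_pow]
      have h2 : r j ^ γ j * (r j)⁻¹ = r j ^ (γ j - 1 - k) * r j ^ (k : ℕ) := by
        have h0 : γ j - 1 - (k : ℕ) + k + 1 = γ j := by have := k.2; omega
        calc r j ^ γ j * (r j)⁻¹ = r j ^ (γ j - 1 - (k : ℕ) + k + 1) * (r j)⁻¹ := by rw [h0]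
          _ = _ := by rw [pow_succ, mul_assoc, mul_inv_cancel₀ (hr j).ne', mul_one, pow_add]
      have h3 : ∏ i with i < j, |z i ^ γ i| ≤ ∏ i with i < j, r i ^ γ i := by
        refine Finset.prod_le_prod (fun _ _ => abs_nonneg _) fun i _ => ?_
        rw [abs_pow]; exact pow_le_pow_left₀ (abs_nonneg _) (hz i) _
      have h4 : |z j| ^ (γ j - 1 - k) ≤ r j ^ (γ j - 1 - (k:ℕ)) :=
        pow_le_pow_left₀ (abs_nonneg _) (hz j) _
      have h5 : 0 ≤ ∏ i with j < i, r i ^ γ i := Finset.prod_nonneg fun i _ => pow_nonneg (hr i).le _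
      have h6 : 0 ≤ ∏ i with i < j, r i ^ γ i := Finset.prod_nonneg fun i _ => pow_nonneg (hr i).le _
      have h7 : 0 ≤ r j ^ (k:ℕ) := pow_nonneg (hr j).le _
      calc _ ≤ |c γ| * ((∏ i with i < j, r i ^ γ i) * r j ^ (γ j - 1 - (k:ℕ))) *
            (r j ^ (k:ℕ) * ∏ i with j < i, r i ^ γ i) := by
              gcongr
        _ = |c γ| * ((∏ i with i < j, r i ^ γ i) * (r j ^ γ j * (r j)⁻¹) *
              ∏ i with j < i, r i ^ γ i) := by rw [h2]; ring
        _ = _ := by ring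
    refine (Finset.sum_le_sum fun k _ => h1 k).trans ?_
    rw [Finset.sum_const, Finset.card_univ, Fintype.card_fin, nsmul_eq_mul]
    have h8 : mon (fun i => 2 * r i) γ = (∏ i, (2:ℝ) ^ γ i) * mon r γ := by
      simp [mon, mul_pow, Finset.prod_mul_distrib]
    have h9 : (γ j : ℝ) ≤ ∏ i, (2:ℝ) ^ γ i := by
      calc (γ j : ℝ) ≤ 2 ^ γ j := by exact_mod_cast Nat.lt_two_pow_self.le
        _ ≤ 2 ^ (∑ i, γ i) := pow_le_pow_right₀ (by norm_num)
            (Finset.single_le_sum (f := γ) (fun _ _ => Nat.zero_le _) (Finset.mem_univ j))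
        _ = _ := (Finset.prod_pow_eq_pow_sum _ _ _).symm
    rw [h8]
    calc (γ j : ℝ) * (|c γ| * mon r γ * (r j)⁻¹) = |c γ| * (γ j * mon r γ) * (r j)⁻¹ := by ring
      _ ≤ _ := by
        have := (mon_pos hr γ).le
        have := (hr j).le
        gcongr
  refine ⟨fun j x => ∑' k, coef j k * mon x (e j k), fun j => PS.of_family hr _ _ (hsum j)
    fun x hx => (summable_of_polydisc (hsum j) hx).hasSum, fun x hx => ?_⟩
  have hx2 : ∀ y : Fin d → ℝ, (∀ i, |y i| ≤ r i) → ∀ i, |y i| ≤ 2 * r i :=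
    fun y hy i => (hy i).trans (by linarith [hr i])
  have h1 := (hc2 x (hx2 x hx)).sub (hc2 z (hx2 z hz))
  have h2 : HasSum (fun γ => ∑ j, (x j - z j) * ∑ k : Fin (γ j), coef j ⟨γ, k⟩ * mon x (e j ⟨γ, k⟩))
      (∑ j, (x j - z j) * ∑' k, coef j k * mon x (e j k)) := by
    refine hasSum_sum fun j _ => HasSum.mul_left _ ?_
    exact (summable_of_polydisc (hsum j) hx).hasSum.sigma fun γ => hasSum_fintype _
  suffices h3 : (fun γ => c γ * mon x γ - c γ * mon z γ) = fun γ =>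
      ∑ j, (x j - z j) * ∑ k : Fin (γ j), coef j ⟨γ, k⟩ * mon x (e j ⟨γ, k⟩) by
    rw [h3] at h1
    exact h1.unique h2
  funext γ
  rw [← mul_sub, mon_sub_mon, Finset.mul_sum]
  refine Finset.sum_congr rfl fun j _ => ?_
  rw [Finset.sum_range, Finset.mul_sum, Finset.sum_mul, Finset.mul_sum, Finset.mul_sum,
    Finset.mul_sum]
  refine Finset.sum_congr rfl fun k _ => ?_
  rw [hmon]
  simp only [coef]
  ring

/-- Absolutely summable families. -/
abbrev L1 (Γ : Type*) := lp (fun _ : Γ => ℝ) 1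

section L1
variable {Γ : Type*} {Y : Type*} [NormedAddCommGroup Y] [NormedSpace ℝ Y] [CompleteSpace Y]

lemma L1.hasSum_abs (c : L1 Γ) : HasSum (fun γ => |c γ|) ‖c‖ := by
  have := lp.hasSum_norm (p := 1) (by simp) c
  simpa using this

/-- The element of `L1 Γ` given by an absolutely summable family. -/
def L1.mk (c : Γ → ℝ) (h : Summable fun γ => |c γ|) : L1 Γ :=
  ⟨c, memℓp_gen (by simpa using h)⟩

lemma L1.mk_apply (c : Γ → ℝ) (h : Summable fun γ => |c γ|) (γ : Γ) : L1.mk c h γ = c γ := rfl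

lemma L1.norm_mk (c : Γ → ℝ) (h : Summable fun γ => |c γ|) : ‖L1.mk c h‖ = ∑' γ, |c γ| :=
  ((L1.hasSum_abs (L1.mk c h)).tsum_eq).symm

lemma L1.summable_smul {k : Γ → Y} {B : ℝ} (hk : ∀ γ, ‖k γ‖ ≤ B) (c : L1 Γ) :
    Summable fun γ => c γ • k γ := by
  refine Summable.of_norm_bounded ((L1.hasSum_abs c).summable.mul_right B) fun γ => ?_
  rw [norm_smul]
  exact mul_le_mul_of_nonneg_left (hk γ) (norm_nonneg _)

/-- The bounded operator on `L1 Γ` whose value at the `γ`-th unit vector is `k γ`. -/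
noncomputable def L1.lift (k : Γ → Y) (B : ℝ) (hk : ∀ γ, ‖k γ‖ ≤ B) : L1 Γ →L[ℝ] Y :=
  LinearMap.mkContinuous
    { toFun := fun c => ∑' γ, c γ • k γ
      map_add' := fun a b => by
        rw [← (L1.summable_smul hk a).tsum_add (L1.summable_smul hk b)]
        simp [add_smul]
      map_smul' := fun a b => by
        simp only [RingHom.id_apply]
        rw [← (L1.summable_smul hk b).tsum_const_smul]
        simp [mul_smul] } B fun c => by
      refine tsum_of_norm_bounded ((L1.hasSum_abs c).mul_left B) fun γ => ?_
      rw [norm_smul, mul_comm]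
      exact mul_le_mul_of_nonneg_right (hk γ) (norm_nonneg _)

lemma L1.lift_apply (k : Γ → Y) (B : ℝ) (hk : ∀ γ, ‖k γ‖ ≤ B) (c : L1 Γ) :
    L1.lift k B hk c = ∑' γ, c γ • k γ := rfl

lemma L1.norm_lift_le (k : Γ → Y) (B : ℝ) (hB : 0 ≤ B) (hk : ∀ γ, ‖k γ‖ ≤ B) :
    ‖L1.lift k B hk‖ ≤ B :=
  LinearMap.mkContinuous_norm_le _ hB _

end L1

section division
variable {d : ℕ}

open Classical in
/-- Shift of coefficient families, i.e. multiplication by a monomial. -/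
noncomputable def L1.shift (μ : Fin d → ℕ) : L1 (Fin d → ℕ) →L[ℝ] L1 (Fin d → ℕ) :=
  L1.lift (fun δ => lp.single 1 (δ + μ) (1 : ℝ)) 1 fun δ => by
    rw [lp.norm_single (by simp)]; simp

/-- Evaluation at `x` of the series with coefficients rescaled by the polyradius `r`. -/
noncomputable def L1.ev {r x : Fin d → ℝ} (hr : ∀ i, 0 < r i) (hx : ∀ i, |x i| ≤ r i) :
    L1 (Fin d → ℕ) →L[ℝ] ℝ :=
  L1.lift (fun γ => mon x γ / mon r γ) 1 fun γ => by
    rw [Real.norm_eq_abs, abs_div, abs_of_pos (mon_pos hr γ)]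
    exact div_le_one_of_le₀ (abs_mon_le hx γ) (mon_pos hr γ).le

lemma L1.ev_apply {r x : Fin d → ℝ} (hr : ∀ i, 0 < r i) (hx : ∀ i, |x i| ≤ r i)
    (c : L1 (Fin d → ℕ)) : L1.ev hr hx c = ∑' γ, c γ * (mon x γ / mon r γ) := rfl

lemma L1.hasSum_ev {r x : Fin d → ℝ} (hr : ∀ i, 0 < r i) (hx : ∀ i, |x i| ≤ r i)
    (c : L1 (Fin d → ℕ)) : HasSum (fun γ => c γ * (mon x γ / mon r γ)) (L1.ev hr hx c) := by
  refine (L1.summable_smul (B := 1) (k := fun γ => mon x γ / mon r γ) (fun γ => ?_) c).hasSum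
  rw [Real.norm_eq_abs, abs_div, abs_of_pos (mon_pos hr γ)]
  exact div_le_one_of_le₀ (abs_mon_le hx γ) (mon_pos hr γ).le

lemma L1.ev_single [DecidableEq (Fin d → ℕ)] {r x : Fin d → ℝ} (hr : ∀ i, 0 < r i)
    (hx : ∀ i, |x i| ≤ r i) (γ : Fin d → ℕ) (a : ℝ) :
    L1.ev hr hx (lp.single 1 γ a) = a * (mon x γ / mon r γ) := by
  rw [L1.ev_apply, tsum_eq_single γ]
  · simp
  · intro δ hδ
    rw [lp.single_apply_ne _ _ _ hδ, zero_mul]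

lemma L1.ev_shift {r x : Fin d → ℝ} (hr : ∀ i, 0 < r i) (hx : ∀ i, |x i| ≤ r i)
    (μ : Fin d → ℕ) (c : L1 (Fin d → ℕ)) :
    L1.ev hr hx (L1.shift μ c) = mon x μ / mon r μ * L1.ev hr hx c := by
  classical
  have h1 : ∀ δ : Fin d → ℕ, ‖(lp.single 1 (δ + μ) (1 : ℝ) : L1 (Fin d → ℕ))‖ ≤ 1 := fun δ => by
    rw [lp.norm_single (by simp)]; simp
  unfold L1.shift
  rw [L1.lift_apply, (L1.ev hr hx).map_tsum (L1.summable_smul (B := 1)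
    (fun δ => by rw [lp.norm_single (by simp)]; simp) c), L1.ev_apply, ← tsum_mul_left]
  refine tsum_congr fun δ => ?_
  rw [map_smul, L1.ev_single, mon_add, mon_add, smul_eq_mul]
  have := (mon_pos hr μ).ne'
  have := (mon_pos hr δ).ne'
  field_simp

theorem PSWith.division {r : Fin d → ℝ} (hr : ∀ i, 0 < r i) (T : Finset (Fin d → ℕ))
    (F : (Fin d → ℕ) → (Fin d → ℝ) → ℝ) (C : (Fin d → ℕ) → (Fin d → ℕ) → ℝ)
    (hF : ∀ e ∈ T, PSWith r (C e) (F e)) (h1 : ∀ e ∈ T, C e e = 1)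
    (ht : ∀ e ∈ T, ∑' δ, (if δ = e then 0 else |C e δ| * mon r δ) ≤ mon r e / 2)
    {f : (Fin d → ℝ) → ℝ} (hf : PS r f) :
    ∃ q : (Fin d → ℕ) → (Fin d → ℝ) → ℝ, (∀ e, PS r (q e)) ∧
      ∃ c, PSWith r c (f - ∑ e ∈ T, q e * F e) ∧ ∀ γ, (∃ e ∈ T, e ≤ γ) → c γ = 0 := by
  classical
  obtain ⟨cf, hcf, hcf2⟩ := hf
  have hrn := fun γ => (mon_pos hr γ).ne'
  -- the assignment
  obtain ⟨asg, hasg⟩ : ∃ asg : (Fin d → ℕ) → Option (Fin d → ℕ), ∀ γ,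
      (∃ e ∈ T, e ≤ γ ∧ asg γ = some e) ∨ ((∀ e ∈ T, ¬ e ≤ γ) ∧ asg γ = none) := by
    have : ∀ γ, ∃ o : Option (Fin d → ℕ),
      (∃ e ∈ T, e ≤ γ ∧ o = some e) ∨ ((∀ e ∈ T, ¬ e ≤ γ) ∧ o = none) := by
     intro γ
     by_cases h : ∃ e ∈ T, e ≤ γ
     · obtain ⟨e, he, heγ⟩ := h
       exact ⟨some e, Or.inl ⟨e, he, heγ, rfl⟩⟩
     · push Not at h
       exact ⟨none, Or.inr ⟨h, rfl⟩⟩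
    exact Classical.skolem.1 this
  -- the tails
  have htail : ∀ e ∈ T, ∃ t : L1 (Fin d → ℕ), ‖t‖ ≤ 1 / 2 ∧
      ∀ (x : Fin d → ℝ) (hx : ∀ i, |x i| ≤ r i), F e x = mon r e * (mon x e / mon r e + L1.ev hr hx t) := by
    intro e he
    have hs0 : Summable fun δ => (if δ = e then 0 else |C e δ| * mon r δ) := by
      refine Summable.of_nonneg_of_le (fun δ => ?_) (fun δ => ?_) (hF e he).1
      · split_ifs
        · exact le_rfl
        · exact mul_nonneg (abs_nonneg _) (mon_pos hr _).le
      · split_ifs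
        · exact mul_nonneg (abs_nonneg _) (mon_pos hr _).le
        · exact le_rfl
    have habs : ∀ δ, |(if δ = e then 0 else C e δ * mon r δ / mon r e)| =
        (if δ = e then 0 else |C e δ| * mon r δ) * (mon r e)⁻¹ := by
      intro δ
      split_ifs
      · simp
      · rw [abs_div, abs_mul, abs_of_pos (mon_pos hr _), abs_of_pos (mon_pos hr _), div_eq_mul_inv]
    have hs : Summable fun δ => |(if δ = e then 0 else C e δ * mon r δ / mon r e)| := by
      simp_rw [habs]; exact hs0.mul_right _
    obtain ⟨t, ht0, htn⟩ : ∃ t : L1 (Fin d → ℕ),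
        (∀ δ, t δ = if δ = e then 0 else C e δ * mon r δ / mon r e) ∧ ‖t‖ ≤ 1 / 2 := by
      refine ⟨L1.mk _ hs, fun δ => rfl, ?_⟩
      rw [L1.norm_mk]
      simp_rw [habs]
      rw [tsum_mul_right, ← div_eq_mul_inv, div_le_iff₀ (mon_pos hr _)]
      linarith [ht e he]
    refine ⟨t, htn, fun x hx => ?_⟩
    have h2 := (L1.hasSum_ev hr hx t).mul_left (mon r e)
    have h3 : HasSum (fun δ => if δ = e then mon x e else 0) (mon x e) := by
      simpa using hasSum_ite_eq e (mon x e)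
    have h4 : (fun γ => C e γ * mon x γ) = fun δ => (if δ = e then mon x e else 0) +
        mon r e * (t δ * (mon x δ / mon r δ)) := by
      funext δ
      rw [ht0]
      have h5 := hrn δ
      have h6 := hrn e
      split_ifs with h
      · rw [h, h1 e he]; ring
      · field_simp; ring
    have h5 := h3.add h2
    rw [← h4] at h5
    have h6 : mon r e * (mon x e / mon r e) = mon x e := mul_div_cancel₀ (mon x e) (hrn e)
    rw [mul_add, h6]
    exact ((hF e he).2 x hx).unique h5
  choose! t ht1 ht2 using htail
  let k : (Fin d → ℕ) → L1 (Fin d → ℕ) := fun γ =>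
    (asg γ).elim 0 fun e => L1.shift (γ - e) (t e)
  have hk : ∀ γ, ‖k γ‖ ≤ 1 / 2 := by
    intro γ
    rcases hasg γ with ⟨e, he, -, h⟩ | ⟨-, h⟩
    · simp only [k, h, Option.elim]
      refine ((L1.shift (γ - e)).le_opNorm _).trans ?_
      have := L1.norm_lift_le (Γ := Fin d → ℕ) (fun δ => (lp.single 1 (δ + (γ - e)) (1 : ℝ) : L1 _)) 1 zero_le_one
        fun δ => by rw [lp.norm_single (by simp)]; simp
      calc _ ≤ 1 * ‖t e‖ := mul_le_mul_of_nonneg_right this (norm_nonneg _)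
        _ ≤ _ := by rw [one_mul]; exact ht1 e he
    · simp [k, h]
  let K := L1.lift k (1 / 2) hk
  have hK : ‖-K‖ < 1 := by
    rw [norm_neg]
    exact (L1.norm_lift_le k _ (by norm_num) hk).trans_lt (by norm_num)
  have hcs : Summable fun γ => |cf γ * mon r γ| := by
    refine hcf.congr fun γ => ?_
    rw [abs_mul, abs_of_pos (mon_pos hr γ)]
  obtain ⟨h, hh⟩ : ∃ h : L1 (Fin d → ℕ), h + K h = L1.mk _ hcs := by
    obtain ⟨u, hu⟩ := isUnit_one_sub_of_norm_lt_one hK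
    refine ⟨(↑u⁻¹ : L1 (Fin d → ℕ) →L[ℝ] L1 (Fin d → ℕ)) (L1.mk _ hcs), ?_⟩
    have := congrArg (fun A : L1 (Fin d → ℕ) →L[ℝ] L1 (Fin d → ℕ) => A (L1.mk _ hcs)) u.mul_inv
    simp only [hu] at this
    simpa using this
  let a : (Fin d → ℕ) → (Fin d → ℕ) → ℝ := fun e γ =>
    if asg γ = some e then h γ * (mon r γ)⁻¹ else 0
  have hsa : ∀ e, Summable fun γ => |a e γ| * mon r (γ - e) := by
    intro e
    refine Summable.of_nonneg_of_le (fun γ => mul_nonneg (abs_nonneg _) (mon_pos hr _).le)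
      (fun γ => ?_) ((L1.hasSum_abs h).summable.mul_right (mon r e)⁻¹)
    rcases hasg γ with ⟨e', he', hle, hγ⟩ | ⟨-, hγ⟩
    · by_cases hee : e' = e
      · subst hee
        simp only [a, hγ, if_true]
        have : mon r γ = mon r (γ - e') * mon r e' := by
          rw [← mon_add, tsub_add_cancel_of_le hle]
        rw [abs_mul, abs_of_pos (inv_pos.2 (mon_pos hr _)), this]
        have := hrn (γ - e')
        have := hrn e'
        refine le_of_eq ?_
        field_simp
      · simp only [a, hγ, Option.some.injEq, hee, if_false, abs_zero, zero_mul]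
        exact mul_nonneg (abs_nonneg _) (inv_pos.2 (mon_pos hr _)).le
    · simp only [a, hγ, reduceCtorEq, if_false, abs_zero, zero_mul]
      exact mul_nonneg (abs_nonneg _) (inv_pos.2 (mon_pos hr _)).le
  refine ⟨fun e x => ∑' γ, a e γ * mon x (γ - e), fun e => PS.of_family hr _ _ (hsa e)
    fun x hx => (summable_of_polydisc (hsa e) hx).hasSum,
    fun γ => if asg γ = none then h γ * (mon r γ)⁻¹ else 0, ⟨?_, fun x hx => ?_⟩, ?_⟩
  · refine Summable.of_nonneg_of_le (fun γ => mul_nonneg (abs_nonneg _) (mon_pos hr _).le)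
      (fun γ => ?_) (L1.hasSum_abs h).summable
    dsimp only
    split_ifs
    · rw [abs_mul, abs_of_pos (inv_pos.2 (mon_pos hr _)), mul_assoc, inv_mul_cancel₀ (hrn γ), mul_one]
    · simp
  · have hev : L1.ev hr hx (h + K h) = f x := by
      rw [hh]
      refine (L1.hasSum_ev hr hx _).unique ?_
      have : (fun γ => L1.mk _ hcs γ * (mon x γ / mon r γ)) = fun γ => cf γ * mon x γ := by
        funext γ
        rw [L1.mk_apply]
        have := hrn γ
        field_simp
      rw [this]
      exact hcf2 x hx
    have hKh : HasSum (fun γ => h γ * L1.ev hr hx (k γ)) (L1.ev hr hx (K h)) := by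
      have := (L1.summable_smul hk h).hasSum.mapL (L1.ev hr hx)
      simp only [map_smul, smul_eq_mul] at this
      exact this
    have h5 := (L1.hasSum_ev hr hx h).add hKh
    rw [← map_add, hev] at h5
    have h6 : HasSum (fun γ => ∑ e ∈ T, a e γ * mon x (γ - e) * F e x)
        (∑ e ∈ T, (∑' γ, a e γ * mon x (γ - e)) * F e x) :=
      hasSum_sum fun e _ => (summable_of_polydisc (hsa e) hx).hasSum.mul_right _
    have h7 := h5.sub h6
    simp only [Pi.sub_apply, Finset.sum_apply, Pi.mul_apply]
    refine Eq.mp (congrArg (fun φ => HasSum φ _) (funext fun γ => ?_)) h7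
    rcases hasg γ with ⟨e, he, hle, hγ⟩ | ⟨-, hγ⟩
    · simp only [a, k, hγ, Option.some.injEq, ite_mul, zero_mul, reduceCtorEq, if_false, Option.elim]
      obtain ⟨E, hE1, hE2⟩ : ∃ E : ℝ, L1.ev hr hx (L1.shift (γ - e) (t e)) =
          mon x (γ - e) / mon r (γ - e) * E ∧ F e x = mon r e * (mon x e / mon r e + E) :=
        ⟨L1.ev hr hx (t e), L1.ev_shift _ _ _ _, ht2 e he x hx⟩
      rw [Finset.sum_ite_eq, if_pos he, hE1, hE2]
      have h8 : ∀ y : Fin d → ℝ, mon y γ = mon y (γ - e) * mon y e := by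
        intro y
        rw [← mon_add, tsub_add_cancel_of_le hle]
      rw [h8 x, h8 r]
      have := hrn (γ - e)
      have := hrn e
      field_simp
      ring
    · simp only [a, k, hγ, reduceCtorEq, if_false, if_true, zero_mul, Finset.sum_const_zero, Option.elim, map_zero]
      ring
  · rintro γ ⟨e, he, hle⟩
    rcases hasg γ with ⟨e', -, -, hγ⟩ | ⟨h', -⟩
    · simp [hγ]
    · exact absurd hle (h' e he)

end division

section Factor

variable {d : ℕ}

/-- The weighted degree of a multi-index. -/
def wt (w : Fin d → ℝ) (γ : Fin d → ℕ) : ℝ := ∑ i, γ i * w i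

/-- The polyradius `s ^ w`. -/
noncomputable def rad (w : Fin d → ℝ) (s : ℝ) (i : Fin d) : ℝ := s ^ w i

lemma rad_pos (w : Fin d → ℝ) {s : ℝ} (hs : 0 < s) (i : Fin d) : 0 < rad w s i :=
  Real.rpow_pos_of_pos hs _

lemma mon_rad (w : Fin d → ℝ) {s : ℝ} (hs : 0 < s) (γ : Fin d → ℕ) :
    mon (rad w s) γ = s ^ wt w γ := by
  unfold mon rad wt
  rw [Real.rpow_sum_of_pos hs]
  refine Finset.prod_congr rfl fun i _ => ?_
  rw [← Real.rpow_natCast, ← Real.rpow_mul hs.le, mul_comm]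

theorem exists_injective_weight (d : ℕ) :
    ∃ w : Fin d → ℝ, (∀ i, 0 < w i) ∧ Function.Injective (wt w) := by
  have htr : Transcendental ℤ (liouvilleNumber 2) := transcendental_liouvilleNumber (m := 2) le_rfl
  have hpos : (0 : ℝ) < liouvilleNumber 2 := by
    by_contra h
    have h0 : 0 ≤ liouvilleNumber 2 := tsum_nonneg fun i => by positivity
    have h1 : liouvilleNumber 2 = 0 := le_antisymm (not_lt.1 h) h0
    rw [h1] at htr
    exact htr (isAlgebraic_zero)
  refine ⟨fun i => liouvilleNumber 2 ^ (i : ℕ), fun i => pow_pos hpos _, fun γ δ h => ?_⟩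
  rw [transcendental_iff] at htr
  have h2 := htr (∑ i : Fin d, Polynomial.monomial (i : ℕ) ((γ i : ℤ) - δ i)) (by
    simp only [map_sum, Polynomial.aeval_monomial]
    unfold wt at h
    rw [← sub_eq_zero, ← Finset.sum_sub_distrib] at h
    rw [← h]
    refine Finset.sum_congr rfl fun i _ => ?_
    simp
    ring)
  funext i
  have h3 := congrArg (fun p => Polynomial.coeff p (i : ℕ)) h2
  simp only [Polynomial.finsetSum_coeff, Polynomial.coeff_monomial, Fin.val_inj,
    Finset.sum_ite_eq', Finset.mem_univ, if_true, Polynomial.coeff_zero] at h3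
  omega

lemma exists_wt_min {w : Fin d → ℝ} (hw : ∀ i, 0 < w i) {S : Set (Fin d → ℕ)} (hS : S.Nonempty) :
    ∃ γ ∈ S, ∀ δ ∈ S, wt w γ ≤ wt w δ := by
  obtain ⟨γ₀, h₀⟩ := hS
  have hfin : {δ | δ ∈ S ∧ wt w δ ≤ wt w γ₀}.Finite := by
    refine (Set.finite_Iic (fun i => ⌊wt w γ₀ / w i⌋₊)).subset ?_
    rintro δ ⟨-, h⟩ i
    refine Nat.le_floor ?_
    rw [le_div_iff₀ (hw i)]
    refine le_trans ?_ h
    exact Finset.single_le_sum (f := fun i => (δ i : ℝ) * w i)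
      (fun j _ => mul_nonneg (Nat.cast_nonneg _) (hw j).le) (Finset.mem_univ i)
  obtain ⟨γ, hγ, hmin⟩ := Set.exists_min_image _ (wt w) hfin ⟨γ₀, h₀, le_rfl⟩
  refine ⟨γ, hγ.1, fun δ hδ => ?_⟩
  by_cases h : wt w δ ≤ wt w γ₀
  · exact hmin δ ⟨hδ, h⟩
  · exact hγ.2.trans (not_le.1 h).le

lemma exists_rad_le {w : Fin d → ℝ} (hw : ∀ i, 0 < w i) {r : Fin d → ℝ} (hr : ∀ i, 0 < r i) :
    ∀ᶠ s in 𝓝[>] (0 : ℝ), ∀ i, rad w s i ≤ r i := by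
  rw [eventually_all]
  intro i
  have : Tendsto (fun s : ℝ => s ^ w i) (𝓝[>] 0) (𝓝 0) := by
    have h := (Real.continuousAt_rpow_const 0 (w i) (Or.inr (hw i).le)).tendsto
    rw [Real.zero_rpow (hw i).ne'] at h
    exact h.mono_left nhdsWithin_le_nhds
  exact (this.eventually (gt_mem_nhds (hr i))).mono fun s hs => le_of_lt hs

lemma eventually_tail_le {w : Fin d → ℝ} (hw : ∀ i, 0 < w i) (hinj : Function.Injective (wt w))
    {r : Fin d → ℝ} (hr : ∀ i, 0 < r i) {c : (Fin d → ℕ) → ℝ}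
    (hc : Summable fun γ => |c γ| * mon r γ) (e : Fin d → ℕ)
    (hmin : ∀ δ, c δ ≠ 0 → wt w e ≤ wt w δ) :
    ∀ᶠ s in 𝓝[>] (0 : ℝ),
      ∑' δ, (if δ = e then 0 else |c δ| * mon (rad w s) δ) ≤ mon (rad w s) e / 2 := by
  obtain ⟨s₁, hs₁, hs₁0, hs₁r⟩ : ∃ s₁ : ℝ, s₁ ≤ 1 ∧ 0 < s₁ ∧ ∀ i, rad w s₁ i ≤ r i := by
    have h1 : ∀ᶠ s in 𝓝[>] (0 : ℝ), s ≤ 1 :=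
      nhdsWithin_le_nhds ((gt_mem_nhds one_pos).mono fun s hs => le_of_lt hs)
    obtain ⟨s, h⟩ := (h1.and (eventually_mem_nhdsWithin.and (exists_rad_le hw hr))).exists
    exact ⟨s, h.1, h.2.1, h.2.2⟩
  have hlim : Tendsto (fun s : ℝ => ∑' δ, (if δ = e then 0 else |c δ| * s ^ (wt w δ - wt w e)))
      (𝓝[>] 0) (𝓝 (∑' _ : Fin d → ℕ, (0 : ℝ))) := by
    refine tendsto_tsum_of_dominated_convergence
      (bound := fun δ => |c δ| * mon (rad w s₁) δ / s₁ ^ wt w e) ?_ ?_ ?_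
    · refine Summable.div_const ?_ _
      refine Summable.of_nonneg_of_le (fun δ => ?_) (fun δ => ?_) hc
      · exact mul_nonneg (abs_nonneg _) (mon_pos (rad_pos w hs₁0) _).le
      · exact mul_le_mul_of_nonneg_left
          (mon_mono (fun i => (rad_pos w hs₁0 i).le) hs₁r δ) (abs_nonneg _)
    · intro δ
      by_cases hδ : δ = e
      · simp [hδ]
      by_cases h0 : c δ = 0
      · simp [h0]
      have hlt : 0 < wt w δ - wt w e :=
        sub_pos.2 (lt_of_le_of_ne (hmin δ h0) fun h => hδ (hinj h).symm)
      have h := (Real.continuousAt_rpow_const 0 _ (Or.inr hlt.le)).tendsto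
      rw [Real.zero_rpow hlt.ne'] at h
      simpa [hδ] using (h.mono_left nhdsWithin_le_nhds).const_mul (|c δ|)
    · filter_upwards [self_mem_nhdsWithin, nhdsWithin_le_nhds (gt_mem_nhds hs₁0)] with s hs hs2 δ
      rw [mon_rad w hs₁0, mul_div_assoc, ← Real.rpow_sub hs₁0]
      have hp : 0 ≤ s₁ ^ (wt w δ - wt w e) := (Real.rpow_pos_of_pos hs₁0 _).le
      split_ifs with h
      · rw [norm_zero]
        exact mul_nonneg (abs_nonneg _) hp
      by_cases h0 : c δ = 0
      · simp [h0]
      rw [norm_mul, norm_abs_eq_norm, Real.norm_eq_abs, Real.norm_eq_abs,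
        abs_of_pos (Real.rpow_pos_of_pos hs _)]
      refine mul_le_mul_of_nonneg_left ?_ (abs_nonneg _)
      exact Real.rpow_le_rpow (le_of_lt hs) hs2.le (sub_nonneg.2 (hmin δ h0))
  rw [tsum_zero] at hlim
  filter_upwards [self_mem_nhdsWithin, hlim.eventually (gt_mem_nhds (half_pos one_pos))] with s hs h
  have hs : 0 < s := hs
  have hp := Real.rpow_pos_of_pos hs (wt w e)
  have heq : ∑' δ, (if δ = e then 0 else |c δ| * mon (rad w s) δ) =
      s ^ wt w e * ∑' δ, (if δ = e then 0 else |c δ| * s ^ (wt w δ - wt w e)) := by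
    rw [← tsum_mul_left]
    refine tsum_congr fun δ => ?_
    split_ifs
    · simp
    · rw [mon_rad w hs, Real.rpow_sub hs]
      field_simp
  rw [heq, mon_rad w hs]
  nlinarith

/-- Ideals of germs at the origin of functions given by convergent power series. -/
structure IsGermIdeal (I : Set ((Fin d → ℝ) → ℝ)) : Prop where
  sub_mem : ∀ f ∈ I, ∀ g ∈ I, f - g ∈ I
  mul_mem : ∀ f ∈ I, ∀ r : Fin d → ℝ, (∀ i, 0 < r i) → ∀ g, PS r g → g * f ∈ I

theorem IsGermIdeal.sub_sum_mem {I : Set ((Fin d → ℝ) → ℝ)} (hI : IsGermIdeal I)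
    {ι : Type*} (T : Finset ι) (g : ι → (Fin d → ℝ) → ℝ) (hg : ∀ e ∈ T, g e ∈ I)
    {f : (Fin d → ℝ) → ℝ} (hf : f ∈ I) : f - ∑ e ∈ T, g e ∈ I := by
  classical
  induction T using Finset.induction_on generalizing f with
  | empty => simpa using hf
  | insert a s ha ih =>
    rw [Finset.sum_insert ha, ← sub_sub]
    exact ih (fun e he => hg e (Finset.mem_insert_of_mem he))
      (hI.sub_mem _ hf _ (hg a (Finset.mem_insert_self _ _)))

/-- An ideal of germs of analytic functions has finitely many generators, with quotients
converging on a fixed basis of polydiscs. -/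
theorem IsGermIdeal.exists_generators {I : Set ((Fin d → ℝ) → ℝ)} (hI : IsGermIdeal I)
    {w : Fin d → ℝ} (hw : ∀ i, 0 < w i) (hinj : Function.Injective (wt w)) :
    ∃ (T : Finset (Fin d → ℕ)) (F : (Fin d → ℕ) → (Fin d → ℝ) → ℝ), (∀ e ∈ T, F e ∈ I) ∧
      ∀ᶠ s in 𝓝[>] (0 : ℝ), ∀ f ∈ I, PS (rad w s) f →
        ∃ q : (Fin d → ℕ) → (Fin d → ℝ) → ℝ, (∀ e ∈ T, PS (rad w s) (q e)) ∧
          ∀ x, (∀ i, |x i| ≤ rad w s i) → f x = ∑ e ∈ T, q e x * F e x := by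
  let A : Set (Fin d → ℕ) := {γ | ∃ f ∈ I, ∃ r : Fin d → ℝ, (∀ i, 0 < r i) ∧ ∃ c, PSWith r c f ∧
    c γ = 1 ∧ ∀ δ, c δ ≠ 0 → wt w γ ≤ wt w δ}
  have hfin : {γ | Minimal (· ∈ A) γ}.Finite :=
    WellQuasiOrderedLE.finite_of_isAntichain (setOfPred_minimal_antichain _)
  let T := hfin.toFinset
  have hTA : ∀ e ∈ T, e ∈ A := fun e he => ((Set.Finite.mem_toFinset hfin).1 he).1
  have hAT : ∀ γ ∈ A, ∃ e ∈ T, e ≤ γ := by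
    intro γ hγ
    obtain ⟨e, he, hm⟩ := exists_minimal_le_of_wellFoundedLT (· ∈ A) γ hγ
    exact ⟨e, (Set.Finite.mem_toFinset hfin).2 hm, he⟩
  choose! F hFI r hr C hC h1 hmin using hTA
  refine ⟨T, F, hFI, ?_⟩
  have hev : ∀ᶠ s in 𝓝[>] (0 : ℝ), ∀ e ∈ T, (∀ i, rad w s i ≤ r e i) ∧
      ∑' δ, (if δ = e then 0 else |C e δ| * mon (rad w s) δ) ≤ mon (rad w s) e / 2 := by
    rw [eventually_all_finset]
    intro e he
    exact (exists_rad_le hw (hr e he)).and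
      (eventually_tail_le hw hinj (hr e he) (hC e he).1 e (hmin e he))
  filter_upwards [hev, self_mem_nhdsWithin] with s hs hs0 f hf hfs
  have hrad := rad_pos w hs0
  obtain ⟨q, hq, c, hc, hc0⟩ := PSWith.division hrad T F C
    (fun e he => (hC e he).mono (fun i => (hrad i).le) (hs e he).1) h1
    (fun e he => (hs e he).2) hfs
  refine ⟨q, fun e _ => hq e, fun x hx => ?_⟩
  have hrem : f - ∑ e ∈ T, q e * F e ∈ I :=
    hI.sub_sum_mem T _ (fun e he => hI.mul_mem _ (hFI e he) _ hrad _ (hq e)) hf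
  have hzero : ∀ γ, c γ = 0 := by
    by_contra hne
    push Not at hne
    obtain ⟨γ, hγ, hγmin⟩ := exists_wt_min hw (S := {γ | c γ ≠ 0}) hne
    have hγA : γ ∈ A := by
      refine ⟨_, hI.mul_mem _ hrem _ hrad _ (PS.const hrad (c γ)⁻¹), _, hrad,
        fun δ => (c γ)⁻¹ * c δ, hc.const_mul _, inv_mul_cancel₀ hγ, fun δ hδ => hγmin δ ?_⟩
      exact right_ne_zero_of_mul hδ
    exact hγ (hc0 γ (hAT γ hγA))
  have h0 : HasSum (fun γ => c γ * mon x γ) 0 := by simp [hzero]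
  have := (hc.2 x hx).unique h0
  simpa [sub_eq_zero] using this

end Factor

section LocalData

variable {d : ℕ}

lemma polydisc_mem_nhds {r : Fin d → ℝ} (hr : ∀ i, 0 < r i) :
    {x : Fin d → ℝ | ∀ i, |x i| ≤ r i} ∈ 𝓝 (0 : Fin d → ℝ) := by
  have : ∀ i, ∀ᶠ x : Fin d → ℝ in 𝓝 0, |x i| ≤ r i := fun i => by
    have h : Tendsto (fun x : Fin d → ℝ => |x i|) (𝓝 0) (𝓝 0) := by
      have h : Continuous fun x : Fin d → ℝ => |x i| := by fun_prop
      simpa using h.tendsto 0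
    exact (h.eventually (gt_mem_nhds (hr i))).mono fun x hx => le_of_lt hx
  exact eventually_all.2 this

lemma PS.eventually_abs_le {r : Fin d → ℝ} (hr : ∀ i, 0 < r i) {g : (Fin d → ℝ) → ℝ} (hg : PS r g) :
    ∃ M, 0 ≤ M ∧ ∀ᶠ x in 𝓝 (0 : Fin d → ℝ), |g x| ≤ M := by
  have hc : ContinuousAt g 0 := hg.continuousOn.continuousAt (polydisc_mem_nhds hr)
  refine ⟨|g 0| + 1, by positivity, ?_⟩
  have := hc.abs.eventually (gt_mem_nhds (lt_add_one |g 0|))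
  exact this.mono fun x hx => le_of_lt hx

lemma exists_PS_rad {w : Fin d → ℝ} (hw : ∀ i, 0 < w i) {f : (Fin d → ℝ) → ℝ}
    (hf : AnalyticAt ℝ f 0) : ∀ᶠ s in 𝓝[>] (0 : ℝ), PS (fun i => 2 * rad w s i) f := by
  obtain ⟨ρ, hρ, h⟩ := PS.exists_of_analyticAt hf
  filter_upwards [exists_rad_le hw (r := fun _ => ρ / 2) fun _ => half_pos hρ,
    eventually_mem_nhdsWithin] with s hs hs0
  refine h.mono (fun i => ?_) fun i => ?_
  · have := rad_pos w hs0 i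
    positivity
  · linarith [hs i]

lemma PS.of_double {r : Fin d → ℝ} (hr : ∀ i, 0 < r i) {f : (Fin d → ℝ) → ℝ}
    (h : PS (fun i => 2 * r i) f) : PS r f :=
  h.mono (fun i => (hr i).le) fun i => by linarith [hr i]

lemma exists_dominating_zero (f : ℕ → (Fin d → ℝ) → ℝ) (hf : ∀ j, AnalyticAt ℝ (f j) 0) :
    ∃ (R : ℕ) (M : ℝ), ∀ᶠ x in 𝓝 (0 : Fin d → ℝ), |f R x| ≤ M * ∑ j ∈ Finset.range R, |f j x| := by
  let I : Set ((Fin d → ℝ) → ℝ) := {g | ∃ (R : ℕ) (M : ℝ), 0 ≤ M ∧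
    ∀ᶠ x in 𝓝 (0 : Fin d → ℝ), |g x| ≤ M * ∑ j ∈ Finset.range R, |f j x|}
  have hmono : ∀ {R R' : ℕ} (_ : R ≤ R') (x : Fin d → ℝ),
      ∑ j ∈ Finset.range R, |f j x| ≤ ∑ j ∈ Finset.range R', |f j x| := fun h x =>
    Finset.sum_le_sum_of_subset_of_nonneg (Finset.range_mono h) fun _ _ _ => abs_nonneg _
  have hI : IsGermIdeal I := by
    constructor
    · rintro g ⟨R, M, hM, h⟩ g' ⟨R', M', hM', h'⟩
      refine ⟨max R R', M + M', add_nonneg hM hM', ?_⟩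
      filter_upwards [h, h'] with x hx hx'
      rw [Pi.sub_apply, add_mul]
      refine (abs_sub _ _).trans (add_le_add (hx.trans ?_) (hx'.trans ?_))
      · exact mul_le_mul_of_nonneg_left (hmono (le_max_left _ _) x) hM
      · exact mul_le_mul_of_nonneg_left (hmono (le_max_right _ _) x) hM'
    · rintro g ⟨R, M, hM, h⟩ r hr q hq
      obtain ⟨B, hB, hB2⟩ := hq.eventually_abs_le hr
      refine ⟨R, B * M, mul_nonneg hB hM, ?_⟩
      filter_upwards [h, hB2] with x hx hx2
      rw [Pi.mul_apply, abs_mul, mul_assoc]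
      exact mul_le_mul hx2 hx (abs_nonneg _) hB
  obtain ⟨w, hw, hinj⟩ := exists_injective_weight d
  obtain ⟨T, F, hF, hgen⟩ := hI.exists_generators hw hinj
  choose! R M hM hRM using hF
  let R₀ := T.sup R
  obtain ⟨s, ⟨hs, hps⟩, hs0⟩ := ((hgen.and (exists_PS_rad hw (hf R₀))).and
    eventually_mem_nhdsWithin).exists
  have hrad := rad_pos w hs0
  have hmem : f R₀ ∈ I := by
    refine ⟨R₀ + 1, 1, zero_le_one, Eventually.of_forall fun x => ?_⟩
    rw [one_mul]
    exact Finset.single_le_sum (f := fun j => |f j x|) (fun _ _ => abs_nonneg _)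
      (Finset.self_mem_range_succ R₀)
  obtain ⟨q, hq, hfq⟩ := hs _ hmem (hps.of_double hrad)
  have hB : ∀ e ∈ T, ∃ B, 0 ≤ B ∧ ∀ᶠ x in 𝓝 (0 : Fin d → ℝ), |q e x| ≤ B :=
    fun e he => (hq e he).eventually_abs_le hrad
  choose! B hB0 hB using hB
  refine ⟨R₀, ∑ e ∈ T, B e * M e, ?_⟩
  filter_upwards [(eventually_all_finset T).2 hB, (eventually_all_finset T).2 hRM,
    polydisc_mem_nhds hrad] with x h1 h2 h3
  rw [hfq x h3, Finset.sum_mul]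
  refine (Finset.abs_sum_le_sum_abs _ _).trans (Finset.sum_le_sum fun e he => ?_)
  rw [abs_mul, mul_assoc]
  refine mul_le_mul (h1 e he) ((h2 e he).trans ?_) (abs_nonneg _) (hB0 e he)
  exact mul_le_mul_of_nonneg_left (hmono (Finset.le_sup he) x) (hM e he)

lemma AnalyticAt.comp_add_left {f : (Fin d → ℝ) → ℝ} {x₀ : Fin d → ℝ} (hf : AnalyticAt ℝ f x₀) :
    AnalyticAt ℝ (fun u => f (x₀ + u)) 0 := by
  have h : AnalyticAt ℝ (fun u : Fin d → ℝ => x₀ + u) 0 := analyticAt_const.add analyticAt_id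
  exact AnalyticAt.fun_comp (by simpa using hf) h

/-- In a sequence of germs of analytic functions, some term is bounded by its predecessors. -/
theorem exists_dominating (f : ℕ → (Fin d → ℝ) → ℝ) (x₀ : Fin d → ℝ)
    (hf : ∀ j, AnalyticAt ℝ (f j) x₀) :
    ∃ (R : ℕ) (M : ℝ), ∀ᶠ x in 𝓝 x₀, |f R x| ≤ M * ∑ j ∈ Finset.range R, |f j x| := by
  obtain ⟨R, M, h⟩ := exists_dominating_zero (fun j u => f j (x₀ + u))
    fun j => AnalyticAt.comp_add_left (hf j)
  refine ⟨R, M, ?_⟩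
  have ht : Tendsto (fun x => x - x₀) (𝓝 x₀) (𝓝 0) := by
    have h : Continuous fun x : Fin d → ℝ => x - x₀ := by fun_prop
    simpa using h.tendsto x₀
  simpa using ht.eventually h

/-- The Jacobian matrix of a family of functions. -/
noncomputable def jacMat (g : Fin d → (Fin d → ℝ) → ℝ) (x : Fin d → ℝ) : Matrix (Fin d) (Fin d) ℝ :=
  Matrix.of fun i j => pderiv' j (g i) x

/-- The Jacobian determinant of a family of functions. -/
noncomputable def jac (g : Fin d → (Fin d → ℝ) → ℝ) (x : Fin d → ℝ) : ℝ := (jacMat g x).det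

lemma hasFDerivAt_sub_mul (j : Fin d) (z : Fin d → ℝ) (a : (Fin d → ℝ) → ℝ)
    (ha : ContinuousAt a z) :
    HasFDerivAt (fun x => (x j - z j) * a x)
      (a z • (ContinuousLinearMap.proj j : (Fin d → ℝ) →L[ℝ] ℝ)) z := by
  rw [hasFDerivAt_iff_isLittleO]
  have h1 : (fun x : Fin d → ℝ => x j - z j) =O[𝓝 z] fun x => ‖x - z‖ :=
    Asymptotics.IsBigO.of_bound 1 (Eventually.of_forall fun x => by
      rw [one_mul, norm_norm]; exact norm_le_pi_norm (x - z) j)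
  have h2 : (fun x => a x - a z) =o[𝓝 z] fun _ => (1 : ℝ) := by
    rw [Asymptotics.isLittleO_one_iff]
    have h : ContinuousAt (fun x => a x - a z) z := ha.sub continuousAt_const
    simpa using h.tendsto
  have h3 := h1.mul_isLittleO h2
  simp only [mul_one] at h3
  refine h3.of_norm_right.congr_left fun x => ?_
  simp
  ring

lemma PS.det {r : Fin d → ℝ} (hr : ∀ i, 0 < r i) {n : ℕ} (a : Fin n → Fin n → (Fin d → ℝ) → ℝ)
    (ha : ∀ i j, PS r (a i j)) : PS r (fun x => (Matrix.of fun i j => a i j x).det) := by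
  have h : PS r (∑ σ : Equiv.Perm (Fin n), (fun _ => ((Equiv.Perm.sign σ : ℤ) : ℝ)) *
      ∏ i, a (σ i) i) :=
    PS.sum hr _ fun σ _ => (PS.const hr _).mul hr (PS.prod hr _ fun i _ => ha _ _)
  convert h using 1
  funext x
  simp [Matrix.det_apply', Finset.sum_apply, Finset.prod_apply]

lemma eventually_not_nondegenerate_zero (g : Fin d → (Fin d → ℝ) → ℝ)
    (hg : ∀ i, AnalyticAt ℝ (g i) 0) :
    ∀ᶠ x in 𝓝[≠] (0 : Fin d → ℝ), ¬((∀ i, g i x = 0) ∧ jac g x ≠ 0) := by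
  by_contra hcon
  rw [← Filter.Frequently] at hcon
  let Z : Set (Fin d → ℝ) := {x | (∀ i, g i x = 0) ∧ jac g x ≠ 0}
  let l := 𝓝[≠] (0 : Fin d → ℝ) ⊓ 𝓟 Z
  have : l.NeBot := Filter.frequently_mem_iff_neBot.1 hcon
  have hl : l ≤ 𝓝 0 := inf_le_left.trans nhdsWithin_le_nhds
  have hlZ : ∀ᶠ x in l, x ∈ Z := mem_inf_of_right (mem_principal_self _)
  have hl0 : ∀ᶠ x in l, x ≠ 0 := mem_inf_of_left self_mem_nhdsWithin
  let I : Set ((Fin d → ℝ) → ℝ) := {f | ∀ᶠ x in l, f x = 0}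
  have hI : IsGermIdeal I := by
    constructor
    · intro f hf f' hf'
      change ∀ᶠ x in l, (f - f') x = 0
      filter_upwards [hf, hf'] with x h h'
      simp [h, h']
    · intro f hf r hr q hq
      change ∀ᶠ x in l, (q * f) x = 0
      filter_upwards [hf] with x h
      simp [h]
  obtain ⟨w, hw, hinj⟩ := exists_injective_weight d
  obtain ⟨T, F, hF, hgen⟩ := hI.exists_generators hw hinj
  obtain ⟨s, ⟨hs, hps⟩, hs0⟩ := ((hgen.and (eventually_all.2 fun i => exists_PS_rad hw (hg i))).and
    eventually_mem_nhdsWithin).exists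
  have hrad := rad_pos w hs0
  have hhalf : ∀ i, 0 < rad w s i / 2 := fun i => half_pos (hrad i)
  have hpoly := hl (polydisc_mem_nhds hhalf)
  replace hF : ∀ e ∈ T, ∀ᶠ x in l, F e x = 0 := hF
  obtain ⟨z, hzF, hzZ, hz0, hzp⟩ := (((eventually_all_finset T).2 hF).and
    (hlZ.and (hl0.and hpoly))).exists
  have hzp : ∀ i, |z i| ≤ rad w s i / 2 := hzp
  have hzr : ∀ i, |z i| ≤ rad w s i := fun i => (hzp i).trans (half_lt_self (hrad i)).le
  have hznhds : {x : Fin d → ℝ | ∀ i, |x i| ≤ rad w s i} ∈ 𝓝 z := by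
    have : ∀ i, ∀ᶠ x : Fin d → ℝ in 𝓝 z, |x i| ≤ rad w s i := fun i => by
      have h : Continuous fun x : Fin d → ℝ => |x i| := by fun_prop
      have hlt : |z i| < rad w s i := (hzp i).trans_lt (half_lt_self (hrad i))
      exact ((h.tendsto z).eventually (gt_mem_nhds hlt)).mono fun x hx => le_of_lt hx
    exact eventually_all.2 this
  have had := fun i => PS.hadamard hrad (hps i) hzr
  choose a ha hga using had
  have hPS := PS.det hrad a ha
  have hmem : (fun x => (Matrix.of fun i j => a i j x).det) ∈ I := by
    have hne : ∀ᶠ x in l, x ≠ z := hl (isOpen_ne.mem_nhds hz0.symm)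
    change ∀ᶠ x in l, (Matrix.of fun i j => a i j x).det = 0
    filter_upwards [hne, hlZ, hpoly] with x hxz hxZ hxp
    refine Matrix.exists_mulVec_eq_zero_iff.1 ⟨x - z, sub_ne_zero.2 hxz, ?_⟩
    funext i
    have h := hga i x fun j => (hxp j).trans (half_lt_self (hrad j)).le
    rw [hxZ.1 i, hzZ.1 i, sub_zero] at h
    rw [Pi.zero_apply, h]
    simp only [Matrix.mulVec, dotProduct, Matrix.of_apply, Pi.sub_apply]
    exact Finset.sum_congr rfl fun j _ => mul_comm _ _
  obtain ⟨q, -, hq⟩ := hs _ hmem hPS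
  have hzero := hq z hzr
  rw [Finset.sum_eq_zero fun e he => by rw [hzF e he, mul_zero]] at hzero
  refine hzZ.2 ?_
  rw [← hzero]
  unfold jac jacMat
  congr 1
  ext i j
  simp only [Matrix.of_apply]
  have hd : HasFDerivAt (g i)
      (∑ j, a i j z • (ContinuousLinearMap.proj j : (Fin d → ℝ) →L[ℝ] ℝ)) z := by
    have h1 : HasFDerivAt (fun x => g i z + ∑ j, (x j - z j) * a i j x)
        (∑ j, a i j z • (ContinuousLinearMap.proj j : (Fin d → ℝ) →L[ℝ] ℝ)) z :=
      (HasFDerivAt.fun_sum fun j _ => hasFDerivAt_sub_mul j z (a i j)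
        ((ha i j).continuousOn.continuousAt hznhds)).const_add _
    refine h1.congr_of_eventuallyEq ?_
    filter_upwards [hznhds] with x hx
    rw [← hga i x hx]
    ring
  unfold pderiv'
  rw [hd.fderiv]
  simp [Pi.single_apply]

lemma pderiv'_comp_add_left (j : Fin d) (f : (Fin d → ℝ) → ℝ) (x₀ u : Fin d → ℝ) :
    pderiv' j (fun u => f (x₀ + u)) u = pderiv' j f (x₀ + u) := by
  unfold pderiv'
  rw [fderiv_comp_add_left]

/-- Nondegenerate common zeros of `d` analytic functions cannot accumulate. -/
theorem eventually_not_nondegenerate (g : Fin d → (Fin d → ℝ) → ℝ) (x₀ : Fin d → ℝ)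
    (hg : ∀ i, AnalyticAt ℝ (g i) x₀) :
    ∀ᶠ x in 𝓝[≠] x₀, ¬((∀ i, g i x = 0) ∧ jac g x ≠ 0) := by
  have h := eventually_not_nondegenerate_zero (fun i u => g i (x₀ + u))
    fun i => AnalyticAt.comp_add_left (hg i)
  rw [eventually_nhdsWithin_iff] at h ⊢
  have ht : Tendsto (fun x => x - x₀) (𝓝 x₀) (𝓝 0) := by
    have h : Continuous fun x : Fin d → ℝ => x - x₀ := by fun_prop
    simpa using h.tendsto x₀
  filter_upwards [ht.eventually h] with x hx hxx
  have h2 := hx (sub_ne_zero.2 hxx)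
  simpa [jac, jacMat, pderiv'_comp_add_left] using h2

end LocalData

section Flow

variable {V : Type*} [NormedAddCommGroup V] [NormedSpace ℝ V]

lemma exists_integralCurve [CompleteSpace V] {v : V → V} {K B : NNReal} (hK : LipschitzWith K v)
    (hB : ∀ x, ‖v x‖ ≤ B) (x : V) :
    ∃ γ : ℝ → V, γ 0 = x ∧ ∀ t, HasDerivAt γ (v (γ t)) t := by
  have hloc : ∀ n : ℕ, ∃ γ : ℝ → V, γ 0 = x ∧
      ∀ t ∈ Set.Ioo (-((n : ℝ) + 1)) ((n : ℝ) + 1), HasDerivAt γ (v (γ t)) t := by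
    intro n
    have hn : (0 : ℝ) < (n : ℝ) + 1 := by positivity
    have hpl : IsPicardLindelof (fun _ => v)
        (⟨0, by constructor <;> linarith⟩ : Set.Icc (-((n : ℝ) + 1)) ((n : ℝ) + 1)) x
        (B * (n + 1)) 0 B K := by
      refine ⟨fun _ _ => hK.lipschitzOnWith, fun _ _ => continuousOn_const, fun _ _ y _ => hB y, ?_⟩
      simp
    obtain ⟨γ, h0, h⟩ := hpl.exists_eq_forall_mem_Icc_hasDerivWithinAt₀
    exact ⟨γ, h0, fun t ht =>
      (h t (Set.Ioo_subset_Icc_self ht)).hasDerivAt (Icc_mem_nhds ht.1 ht.2)⟩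
  choose γ h0 h using hloc
  have hagree : ∀ m n : ℕ, m ≤ n → ∀ t ∈ Set.Ioo (-((m : ℝ) + 1)) ((m : ℝ) + 1),
      γ m t = γ n t := by
    intro m n hmn
    have hm : (0 : ℝ) < (m : ℝ) + 1 := by positivity
    have hmn' : (m : ℝ) ≤ n := by exact_mod_cast hmn
    refine ODE_solution_unique_of_mem_Ioo (v := fun _ => v) (s := fun _ => Set.univ) (K := K)
      (t₀ := 0) (fun _ _ => hK.lipschitzOnWith) ⟨by linarith, hm⟩
      (fun t ht => ⟨h m t ht, Set.mem_univ _⟩)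
      (fun t ht => ⟨h n t ⟨by linarith [ht.1], by linarith [ht.2]⟩, Set.mem_univ _⟩)
      ((h0 m).trans (h0 n).symm)
  refine ⟨fun t => γ ⌈|t|⌉₊ t, h0 _, fun t => ?_⟩
  have hlt : ∀ s : ℝ, |s| < (⌈|s|⌉₊ : ℝ) + 1 := fun s => (Nat.le_ceil _).trans_lt (lt_add_one _)
  have hev : (fun t => γ ⌈|t|⌉₊ t) =ᶠ[𝓝 t] γ (⌈|t|⌉₊ + 1) := by
    have h1 : ∀ᶠ s : ℝ in 𝓝 t, |s| < (⌈|t|⌉₊ : ℝ) + 1 :=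
      continuous_abs.continuousAt.eventually (gt_mem_nhds (hlt t))
    filter_upwards [h1] with s hs
    refine hagree _ _ ?_ s (abs_lt.1 (hlt s))
    exact Nat.ceil_le.2 (by push_cast; exact hs.le)
  have h2 := h (⌈|t|⌉₊ + 1) t (abs_lt.1 ((hlt t).trans (by push_cast; linarith)))
  have h3 := h2.congr_of_eventuallyEq hev
  have h4 : γ (⌈|t|⌉₊ + 1) t = γ ⌈|t|⌉₊ t := hev.self_of_nhds.symm
  rw [h4] at h3
  exact h3

/-- A bounded Lipschitz vector field has a global flow. -/
theorem exists_flow [CompleteSpace V] {v : V → V} {K B : NNReal} (hK : LipschitzWith K v)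
    (hB : ∀ x, ‖v x‖ ≤ B) :
    ∃ Fl : V → ℝ → V, (∀ x, Fl x 0 = x) ∧ (∀ x t, HasDerivAt (Fl x) (v (Fl x t)) t) ∧
      ∀ x s t, Fl (Fl x s) t = Fl x (s + t) := by
  choose Fl h0 h using exists_integralCurve hK hB
  refine ⟨Fl, h0, h, fun x s t => ?_⟩
  have hs : ∀ t, HasDerivAt (fun t => Fl x (s + t)) (v (Fl x (s + t))) t := fun t =>
    (h x (s + t)).comp_const_add s t
  have := ODE_solution_unique_univ (v := fun _ => v) (s := fun _ => Set.univ) (K := K) (t₀ := 0)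
    (f := Fl (Fl x s)) (g := fun t => Fl x (s + t))
    (fun _ => hK.lipschitzOnWith) (fun t => ⟨h _ t, Set.mem_univ _⟩)
    (fun t => ⟨hs t, Set.mem_univ _⟩) (by simp [h0])
  exact congrFun this t

end Flow

lemma eventually_eq_zero_of_deriv_le {V : Type*} [NormedAddCommGroup V] [NormedSpace ℝ V]
    {φ φ' : ℝ → V} {t₀ C : ℝ} (hd : ∀ t, HasDerivAt φ (φ' t) t)
    (hC : ∀ᶠ t in 𝓝 t₀, ‖φ' t‖ ≤ C * ‖φ t‖) (h0 : φ t₀ = 0) : ∀ᶠ t in 𝓝 t₀, φ t = 0 := by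
  obtain ⟨ε, hε, h⟩ := Metric.eventually_nhds_iff.1 hC
  refine Metric.eventually_nhds_iff.2 ⟨ε, hε, fun t ht => ?_⟩
  rw [Real.dist_eq] at ht
  rcases le_total t₀ t with hle | hle
  · rw [abs_of_nonneg (by linarith)] at ht
    refine eq_zero_of_abs_deriv_le_mul_abs_self_of_eq_zero_right (f := φ) (f' := φ') (K := C)
      (fun s _ => (hd s).continuousAt.continuousWithinAt) (fun s _ => (hd s).hasDerivWithinAt) h0
      (fun s hs => h ?_) t ⟨hle, le_rfl⟩
    rw [Real.dist_eq, abs_of_nonneg] <;> linarith [hs.1, hs.2]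
  · rw [abs_of_nonpos (by linarith)] at ht
    have hd' : ∀ s, HasDerivAt (fun s => φ (-s)) (-φ' (-s)) s := fun s => by
      simpa [Function.comp_def] using (hd (-s)).scomp s (hasDerivAt_neg s)
    have := eq_zero_of_abs_deriv_le_mul_abs_self_of_eq_zero_right (f := fun s => φ (-s))
      (f' := fun s => -φ' (-s)) (K := C) (a := -t₀) (b := -t)
      (fun s _ => (hd' s).continuousAt.continuousWithinAt) (fun s _ => (hd' s).hasDerivWithinAt)
      (by simpa using h0) (fun s hs => by
        rw [norm_neg]
        refine h ?_
        rw [Real.dist_eq, abs_of_nonpos] <;> linarith [hs.1, hs.2]) (-t) ⟨by linarith, le_rfl⟩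
    simpa using this

lemma eventually_succ_eq_zero {u : ℕ → ℝ → ℝ} (hu : ∀ j t, HasDerivAt (u j) (u (j + 1) t) t)
    {t₀ : ℝ} (h0 : ∀ᶠ t in 𝓝 t₀, u 0 t = 0) (j : ℕ) : ∀ᶠ t in 𝓝 t₀, u j t = 0 := by
  induction j with
  | zero => exact h0
  | succ j ih =>
    filter_upwards [eventually_eventually_nhds.2 ih] with t ht
    exact (hu j t).unique ((hasDerivAt_const t (0 : ℝ)).congr_of_eventuallyEq ht)

lemma eventually_eq_zero_of_dominated {u : ℕ → ℝ → ℝ}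
    (hu : ∀ j t, HasDerivAt (u j) (u (j + 1) t) t) {t₀ : ℝ} {R : ℕ} {M : ℝ}
    (hM : ∀ᶠ t in 𝓝 t₀, |u R t| ≤ M * ∑ j ∈ Finset.range R, |u j t|)
    (h0 : ∀ j < R, u j t₀ = 0) : ∀ᶠ t in 𝓝 t₀, u 0 t = 0 := by
  have key : ∀ᶠ t in 𝓝 t₀, (fun j : Fin R => u j t) = 0 := by
    refine eventually_eq_zero_of_deriv_le (φ := fun t (j : Fin R) => u j t)
      (φ' := fun t j => u (j + 1) t) (C := max 1 (|M| * R))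
      (fun t => hasDerivAt_pi.2 fun j => hu j t) ?_ (funext fun j => h0 j j.2)
    filter_upwards [hM] with t ht
    have hn : ∀ j < R, |u j t| ≤ ‖fun j : Fin R => u j t‖ := fun j hj =>
      norm_le_pi_norm (fun j : Fin R => u j t) ⟨j, hj⟩
    refine (pi_norm_le_iff_of_nonneg (by positivity)).2 fun j => ?_
    rw [Real.norm_eq_abs]
    by_cases hj : (j : ℕ) + 1 < R
    · refine (hn _ hj).trans ?_
      exact le_mul_of_one_le_left (norm_nonneg _) (le_max_left _ _)
    · have hjR : (j : ℕ) + 1 = R := by omega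
      rw [hjR]
      refine ht.trans ?_
      have hsum : ∑ j ∈ Finset.range R, |u j t| ≤ R * ‖fun j : Fin R => u j t‖ := by
        refine (Finset.sum_le_card_nsmul _ _ _ fun j hj => hn j (Finset.mem_range.1 hj)).trans ?_
        simp
      calc M * ∑ j ∈ Finset.range R, |u j t| ≤ |M| * ∑ j ∈ Finset.range R, |u j t| :=
            mul_le_mul_of_nonneg_right (le_abs_self M) (Finset.sum_nonneg fun _ _ => abs_nonneg _)
        _ ≤ |M| * (R * ‖fun j : Fin R => u j t‖) := mul_le_mul_of_nonneg_left hsum (abs_nonneg _)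
        _ = |M| * R * ‖fun j : Fin R => u j t‖ := by ring
        _ ≤ _ := mul_le_mul_of_nonneg_right (le_max_right _ _) (norm_nonneg _)
  rcases Nat.eq_zero_or_pos R with rfl | hR
  · filter_upwards [hM] with t ht
    simpa using ht
  · filter_upwards [key] with t ht
    exact congrFun ht ⟨0, hR⟩

/-- If finitely many iterated derivatives vanish at a point, then the function is zero. -/
theorem eq_zero_of_dominated {u : ℕ → ℝ → ℝ} (hu : ∀ j t, HasDerivAt (u j) (u (j + 1) t) t)
    {N : ℕ} (hN : ∀ t₀, ∃ R ≤ N, ∃ M : ℝ,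
      ∀ᶠ t in 𝓝 t₀, |u R t| ≤ M * ∑ j ∈ Finset.range R, |u j t|)
    {t₀ : ℝ} (h0 : ∀ j ≤ N, u j t₀ = 0) (t : ℝ) : u 0 t = 0 := by
  let S : Set ℝ := {t | ∀ j ≤ N, u j t = 0}
  have hclosed : IsClosed S := by
    have : S = ⋂ j, ⋂ (_ : j ≤ N), {t | u j t = 0} := by
      ext t; simp [S]
    rw [this]
    refine isClosed_iInter fun j => isClosed_iInter fun _ => ?_
    have hc : Continuous (u j) := continuous_iff_continuousAt.2 fun t => (hu j t).continuousAt
    exact isClosed_eq hc continuous_const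
  have hopen : IsOpen S := by
    rw [isOpen_iff_mem_nhds]
    intro t₁ ht₁
    obtain ⟨R, hR, M, hM⟩ := hN t₁
    have h1 := eventually_eq_zero_of_dominated hu hM fun j hj => ht₁ j (by omega)
    have h2 : ∀ᶠ t in 𝓝 t₁, ∀ j ∈ Finset.range (N + 1), u j t = 0 :=
      (eventually_all_finset _).2 fun j _ => eventually_succ_eq_zero hu h1 j
    filter_upwards [h2] with t ht j hj
    exact ht j (Finset.mem_range.2 (by omega))
  have huniv : S = Set.univ := IsClopen.eq_univ ⟨hclosed, hopen⟩ ⟨t₀, h0⟩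
  have : t ∈ S := huniv ▸ Set.mem_univ t
  exact this 0 (Nat.zero_le _)

section Jacobian

variable {d : ℕ}

lemma fderiv_apply_eq_sum (f : (Fin d → ℝ) → ℝ) (x v : Fin d → ℝ) :
    fderiv ℝ f x v = ∑ j, v j * pderiv' j f x := by
  conv_lhs => rw [pi_eq_sum_univ' v]
  simp only [map_sum, map_smul, smul_eq_mul, pderiv']

/-- The vector field whose directional derivative of `f` is the Jacobian of `Φ` with the
component `i₀` replaced by `f`. -/
noncomputable def cofField (Φ : Fin d → (Fin d → ℝ) → ℝ) (i₀ : Fin d) (x : Fin d → ℝ) :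
    Fin d → ℝ := fun j => (jacMat Φ x).adjugate j i₀

lemma jacMat_update (Φ : Fin d → (Fin d → ℝ) → ℝ) (i₀ : Fin d) (f : (Fin d → ℝ) → ℝ)
    (x : Fin d → ℝ) :
    jacMat (Function.update Φ i₀ f) x = (jacMat Φ x).updateRow i₀ fun j => pderiv' j f x := by
  ext i j
  by_cases h : i = i₀
  · subst h; simp [jacMat]
  · simp [jacMat, h]

lemma jac_update (Φ : Fin d → (Fin d → ℝ) → ℝ) (i₀ : Fin d) (f : (Fin d → ℝ) → ℝ)
    (x : Fin d → ℝ) :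
    jac (Function.update Φ i₀ f) x = fderiv ℝ f x (cofField Φ i₀ x) := by
  rw [jac, jacMat_update, ← Matrix.cramer_transpose_apply, Matrix.cramer_eq_adjugate_mulVec,
    ← Matrix.adjugate_transpose, fderiv_apply_eq_sum]
  simp [Matrix.mulVec, dotProduct, cofField, Matrix.transpose_apply, mul_comm]

lemma fderiv_cofField_self (Φ : Fin d → (Fin d → ℝ) → ℝ) (i₀ : Fin d) (x : Fin d → ℝ) :
    fderiv ℝ (Φ i₀) x (cofField Φ i₀ x) = jac Φ x := by
  rw [← jac_update, Function.update_eq_self]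

lemma fderiv_cofField_of_ne (Φ : Fin d → (Fin d → ℝ) → ℝ) {i i₀ : Fin d} (h : i ≠ i₀)
    (x : Fin d → ℝ) : fderiv ℝ (Φ i) x (cofField Φ i₀ x) = 0 := by
  rw [← jac_update]
  refine Matrix.det_zero_of_row_eq h ?_
  ext j
  simp [jacMat, h]

lemma fderiv_coord_cofField (Φ : Fin d → (Fin d → ℝ) → ℝ) (i₀ j : Fin d) (x : Fin d → ℝ) :
    fderiv ℝ (fun y : Fin d → ℝ => y j) x (cofField Φ i₀ x) = cofField Φ i₀ x j := by
  have : fderiv ℝ (fun y : Fin d → ℝ => y j) x = ContinuousLinearMap.proj (R := ℝ) (φ := fun _ : Fin d => ℝ) j :=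
    (ContinuousLinearMap.proj (R := ℝ) (φ := fun _ : Fin d => ℝ) j).fderiv
  rw [this]; rfl

lemma AnalyticAt.dirDeriv {f : (Fin d → ℝ) → ℝ} {v : (Fin d → ℝ) → Fin d → ℝ} {x : Fin d → ℝ}
    (hf : AnalyticAt ℝ f x) (hv : AnalyticAt ℝ v x) :
    AnalyticAt ℝ (fun y => fderiv ℝ f y (v y)) x := by
  exact (ContinuousLinearMap.analyticAt_bilinear (ContinuousLinearMap.id ℝ ((Fin d → ℝ) →L[ℝ] ℝ))
    (fderiv ℝ f x, v x)).comp₂ hf.fderiv hv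

lemma AnalyticAt.pderiv' {f : (Fin d → ℝ) → ℝ} {x : Fin d → ℝ} (j : Fin d)
    (hf : AnalyticAt ℝ f x) : AnalyticAt ℝ (pderiv' j f) x :=
  AnalyticAt.dirDeriv hf analyticAt_const

lemma analyticAt_det {n : ℕ} {A : (Fin d → ℝ) → Matrix (Fin n) (Fin n) ℝ} {x : Fin d → ℝ}
    (hA : ∀ i j, AnalyticAt ℝ (fun y => A y i j) x) : AnalyticAt ℝ (fun y => (A y).det) x := by
  simp only [Matrix.det_apply']
  exact Finset.analyticAt_fun_sum _ fun σ _ => analyticAt_const.mul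
    (Finset.analyticAt_fun_prod _ fun i _ => hA _ _)

lemma analyticAt_jac {Φ : Fin d → (Fin d → ℝ) → ℝ} {x : Fin d → ℝ}
    (hΦ : ∀ i, AnalyticAt ℝ (Φ i) x) : AnalyticAt ℝ (jac Φ) x :=
  analyticAt_det fun i j => AnalyticAt.pderiv' j (hΦ i)

lemma analyticAt_cofField {Φ : Fin d → (Fin d → ℝ) → ℝ} {x : Fin d → ℝ}
    (hΦ : ∀ i, AnalyticAt ℝ (Φ i) x) (i₀ : Fin d) : AnalyticAt ℝ (cofField Φ i₀) x := by
  refine AnalyticAt.pi fun j => ?_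
  change AnalyticAt ℝ (fun y => (jacMat Φ y).adjugate j i₀) x
  simp only [Matrix.adjugate_apply]
  refine analyticAt_det fun i k => ?_
  simp only [Matrix.updateRow_apply]
  split_ifs
  · exact analyticAt_const
  · exact AnalyticAt.pderiv' k (hΦ i)

lemma cofField_ne_zero {Φ : Fin d → (Fin d → ℝ) → ℝ} {x : Fin d → ℝ} (h : jac Φ x ≠ 0)
    (i₀ : Fin d) : cofField Φ i₀ x ≠ 0 := by
  intro h0
  apply h
  rw [← fderiv_cofField_self Φ i₀ x, h0, map_zero]

end Jacobian

section OrbitFlow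

variable {d : ℕ}

lemma det_fderiv_eq_jac {g : Fin d → (Fin d → ℝ) → ℝ} {x : Fin d → ℝ}
    (hg : ∀ i, DifferentiableAt ℝ (g i) x) :
    (fderiv ℝ (fun y i => g i y) x).det = jac g x := by
  have h : ((fderiv ℝ (fun y i => g i y) x : (Fin d → ℝ) →L[ℝ] (Fin d → ℝ)) :
      (Fin d → ℝ) →ₗ[ℝ] (Fin d → ℝ)) = Matrix.toLin' (jacMat g x) := by
    refine LinearMap.pi_ext' fun j => LinearMap.ext_ring ?_
    ext i
    simp [fderiv_pi hg, jacMat, pderiv']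
  rw [ContinuousLinearMap.det, h, LinearMap.det_toLin', jac]

/-- `Fl` is a complete flow of the vector field `ζ` on the invariant set `G`. -/
structure OrbitFlow (G : Set (Fin d → ℝ)) (ζ : (Fin d → ℝ) → Fin d → ℝ)
    (Fl : (Fin d → ℝ) → ℝ → Fin d → ℝ) : Prop where
  zero : ∀ x, Fl x 0 = x
  add : ∀ x s t, Fl (Fl x s) t = Fl x (s + t)
  mem : ∀ x ∈ G, ∀ t, Fl x t ∈ G
  deriv : ∀ x ∈ G, ∀ t, HasDerivAt (Fl x) (ζ (Fl x t)) t

lemma exists_orbitFlow {x₀ : Fin d → ℝ} {ε : ℝ} (hε : 0 < ε) {ζ : (Fin d → ℝ) → Fin d → ℝ}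
    (hζ : ∀ x ∈ Metric.closedBall x₀ (2 * ε), ContDiffAt ℝ 1 ζ x) {K G : Set (Fin d → ℝ)}
    (hK : IsClosed K) (hKb : K ⊆ Metric.closedBall x₀ ε) (hG : IsOpen G) (hGK : G ⊆ K)
    (h0 : ∀ x ∈ K, x ∉ G → ζ x = 0) : ∃ Fl, OrbitFlow G ζ Fl := by
  let φ : ContDiffBump x₀ := ⟨ε, 2 * ε, hε, by linarith⟩
  let v : (Fin d → ℝ) → Fin d → ℝ := fun x => φ x • ζ x
  have hvs : HasCompactSupport v := φ.hasCompactSupport.smul_right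
  have hv : ContDiff ℝ 1 v := by
    refine contDiff_iff_contDiffAt.2 fun x => ?_
    by_cases hx : x ∈ Metric.closedBall x₀ (2 * ε)
    · exact φ.contDiff.contDiffAt.smul (hζ x hx)
    · have : v =ᶠ[𝓝 x] fun _ => 0 := by
        have h1 : (Metric.closedBall x₀ (2 * ε))ᶜ ∈ 𝓝 x := Metric.isClosed_closedBall.isOpen_compl.mem_nhds hx
        filter_upwards [h1] with y hy
        have : φ y = 0 := φ.zero_of_le_dist (by
          simp only [Set.mem_compl_iff, Metric.mem_closedBall, not_le] at hy; exact hy.le)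
        simp [v, this]
      exact contDiffAt_const.congr_of_eventuallyEq this
  have hvK : ∀ x ∈ K, v x = ζ x := fun x hx => by
    simp [v, φ.one_of_mem_closedBall (hKb hx)]
  obtain ⟨C, hC⟩ := hv.lipschitzWith_of_hasCompactSupport hvs (by simp)
  obtain ⟨B, hB⟩ := hvs.exists_bound_of_continuous hv.continuous
  obtain ⟨Fl, hF0, hFd, hFa⟩ := exists_flow (B := B.toNNReal) hC
    fun x => (hB x).trans (Real.le_coe_toNNReal B)
  have hstat : ∀ p, v p = 0 → ∀ t, Fl p t = p := by
    intro p hp t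
    have := ODE_solution_unique_univ (v := fun _ => v) (s := fun _ => Set.univ) (K := C) (t₀ := 0)
      (f := Fl p) (g := fun _ => p) (fun _ => hC.lipschitzOnWith)
      (fun t => ⟨hFd p t, Set.mem_univ _⟩)
      (fun t => ⟨by rw [hp]; exact hasDerivAt_const _ _, Set.mem_univ _⟩) (hF0 p)
    exact congrFun this t
  have hcont : ∀ x, Continuous (Fl x) := fun x =>
    continuous_iff_continuousAt.2 fun t => (hFd x t).continuousAt
  have hmem : ∀ x ∈ G, ∀ t, Fl x t ∈ G := by
    intro x hx
    have hA : IsClopen {t | Fl x t ∈ G} := by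
      refine ⟨isClosed_of_closure_subset fun t ht => ?_, hG.preimage (hcont x)⟩
      have htK : Fl x t ∈ K := by
        have h1 : closure {t | Fl x t ∈ G} ⊆ Fl x ⁻¹' K :=
          closure_minimal (fun s hs => hGK hs) (hK.preimage (hcont x))
        exact h1 ht
      by_contra hn
      have h2 := hstat (Fl x t) (by rw [hvK _ htK, h0 _ htK hn]) (-t)
      rw [hFa, add_neg_cancel, hF0] at h2
      exact hn (show Fl x t ∈ G from h2 ▸ hx)
    have := hA.eq_univ ⟨0, by simpa [hF0] using hx⟩
    exact fun t => (Set.ext_iff.1 this t).2 (Set.mem_univ t)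
  exact ⟨Fl, hF0, fun x s t => hFa x s t, hmem, fun x hx t => by
    rw [← hvK _ (hGK (hmem x hx t))]; exact hFd x t⟩

namespace OrbitFlow

variable {G : Set (Fin d → ℝ)} {ζ : (Fin d → ℝ) → Fin d → ℝ} {Fl : (Fin d → ℝ) → ℝ → Fin d → ℝ}

lemma hasDerivAt_comp (h : OrbitFlow G ζ Fl) {f : (Fin d → ℝ) → ℝ}
    {x : Fin d → ℝ} (hx : x ∈ G) (t : ℝ) (hf : DifferentiableAt ℝ f (Fl x t)) :
    HasDerivAt (fun t => f (Fl x t)) (fderiv ℝ f (Fl x t) (ζ (Fl x t))) t :=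
  hf.hasFDerivAt.comp_hasDerivAt t (h.deriv x hx t)

/-- Near a point of `G`, a common level set of all components of `Φ` except the `i₀`-th one is
contained in a single orbit. -/
lemma eventually_mem_orbit (h : OrbitFlow G ζ Fl) {Φ : Fin d → (Fin d → ℝ) → ℝ}
    (hΦ : ∀ x ∈ G, ∀ i, AnalyticAt ℝ (Φ i) x) {i₀ : Fin d} {ρ : (Fin d → ℝ) → ℝ}
    (hζ : ∀ x ∈ G, ζ x = ρ x • cofField Φ i₀ x) (hζc : ∀ x ∈ G, ContinuousAt ζ x)
    (hζ0 : ∀ x ∈ G, ζ x ≠ 0)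
    (hconst : ∀ x ∈ G, ∀ i ≠ i₀, ∀ t, Φ i (Fl x t) = Φ i x) {p : Fin d → ℝ} (hp : p ∈ G) :
    ∀ᶠ q in 𝓝 p, (∀ i ≠ i₀, Φ i q = Φ i p) → ∃ s, q = Fl p s := by
  obtain ⟨j, hj⟩ : ∃ j, ζ p j ≠ 0 := by
    by_contra! hc
    exact hζ0 p hp (funext hc)
  have hξj : cofField Φ i₀ p j ≠ 0 := by
    intro h0; apply hj; rw [hζ p hp]; simp [h0]
  let Ψ : Fin d → (Fin d → ℝ) → ℝ := Function.update Φ i₀ fun y => y j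
  have hΨa : ∀ i, AnalyticAt ℝ (Ψ i) p := by
    intro i
    by_cases hi : i = i₀
    · subst hi
      simp only [Ψ, Function.update_self]
      exact (ContinuousLinearMap.proj (R := ℝ) (φ := fun _ : Fin d => ℝ) j).analyticAt p
    · simp only [Ψ, Function.update_of_ne hi]
      exact hΦ p hp i
  have hjac : jac Ψ p ≠ 0 := by
    rw [jac_update, fderiv_coord_cofField]; exact hξj
  have hstrict : HasStrictFDerivAt (fun y i => Ψ i y) (fderiv ℝ (fun y i => Ψ i y) p) p :=
    (AnalyticAt.pi hΨa).hasStrictFDerivAt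
  have hdet : (fderiv ℝ (fun y i => Ψ i y) p).det ≠ 0 := by
    rwa [det_fderiv_eq_jac fun i => (hΨa i).differentiableAt]
  have hstrict' : HasStrictFDerivAt (fun y i => Ψ i y)
      ((fderiv ℝ (fun y i => Ψ i y) p).toContinuousLinearEquivOfDetNeZero hdet :
        (Fin d → ℝ) →L[ℝ] (Fin d → ℝ)) p := by
    simpa using hstrict
  have hinj := hstrict'.eventually_left_inverse
  have hcont : ContinuousAt (Fl p) 0 := (h.deriv p hp 0).continuousAt
  have hderiv : HasStrictDerivAt (fun s => Fl p s j) (ζ p j) 0 := by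
    have h1 : HasStrictDerivAt (fun s => Fl p s j) (ζ (Fl p 0) j) 0 := by
      refine hasStrictDerivAt_of_hasDerivAt_of_continuousAt (f' := fun s => ζ (Fl p s) j)
        (Eventually.of_forall fun s => hasDerivAt_pi.1 (h.deriv p hp s) j) ?_
      have h2 : ContinuousAt ζ (Fl p 0) := by rw [h.zero]; exact hζc p hp
      exact (continuous_apply j).continuousAt.comp (ContinuousAt.comp (g := ζ) h2 hcont)
    rwa [h.zero] at h1
  have hmap := hderiv.map_nhds_eq hj
  have hO : ∀ᶠ s in 𝓝 (0 : ℝ), hstrict'.localInverse _ _ _ (fun i => Ψ i (Fl p s)) = Fl p s := by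
    have h2 : Tendsto (Fl p) (𝓝 0) (𝓝 p) := by
      have := hcont.tendsto; rwa [h.zero] at this
    exact h2.eventually hinj
  have himg : (fun s => Fl p s j) ''
      {s | hstrict'.localInverse _ _ _ (fun i => Ψ i (Fl p s)) = Fl p s} ∈ 𝓝 (p j) := by
    have : (fun s => Fl p s j) '' {s | hstrict'.localInverse _ _ _ (fun i => Ψ i (Fl p s)) = Fl p s} ∈
        map (fun s => Fl p s j) (𝓝 0) := image_mem_map hO
    rwa [hmap, h.zero] at this
  have hev : ∀ᶠ q : Fin d → ℝ in 𝓝 p, q j ∈ (fun s => Fl p s j) ''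
      {s | hstrict'.localInverse _ _ _ (fun i => Ψ i (Fl p s)) = Fl p s} :=
    (continuous_apply j).continuousAt.eventually himg
  filter_upwards [hinj, hev] with q hq1 hq2 hq3
  obtain ⟨s, hs1, hs2⟩ := hq2
  refine ⟨s, ?_⟩
  refine hq1.symm.trans (Eq.trans ?_ hs1)
  congr 1
  funext i
  by_cases hi : i = i₀
  · subst hi
    simpa [Ψ] using hs2.symm
  · simp only [Ψ, Function.update_of_ne hi]
    rw [hconst p hp i hi, hq3 i hi]

end OrbitFlow

end OrbitFlow

section Counting

variable {d : ℕ}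

/-- The hypotheses shared by the counting lemmas below: a flow along (a rescaling of) the
cofactor field of `Φ` on the invariant set where the rescaling factor is positive. -/
structure CofactorFlow (K : Set (Fin d → ℝ)) (Φ : Fin d → (Fin d → ℝ) → ℝ) (i₀ : Fin d)
    (ρ : (Fin d → ℝ) → ℝ) (Fl : (Fin d → ℝ) → ℝ → Fin d → ℝ) : Prop where
  compact : IsCompact K
  analytic : ∀ x ∈ K, ∀ i, AnalyticAt ℝ (Φ i) x
  analytic_factor : ∀ x ∈ K, AnalyticAt ℝ ρ x
  ne_zero : ∀ x ∈ K, 0 < ρ x → cofField Φ i₀ x ≠ 0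
  flow : OrbitFlow {x | x ∈ K ∧ 0 < ρ x} (fun x => ρ x • cofField Φ i₀ x) Fl

namespace CofactorFlow

variable {K : Set (Fin d → ℝ)} {Φ : Fin d → (Fin d → ℝ) → ℝ} {i₀ : Fin d}
  {ρ : (Fin d → ℝ) → ℝ} {Fl : (Fin d → ℝ) → ℝ → Fin d → ℝ}

/-- The derivative along the rescaled cofactor field. -/
noncomputable def D (Φ : Fin d → (Fin d → ℝ) → ℝ) (i₀ : Fin d) (ρ f : (Fin d → ℝ) → ℝ) :
    (Fin d → ℝ) → ℝ := fun x => fderiv ℝ f x (ρ x • cofField Φ i₀ x)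

lemma D_eq (f : (Fin d → ℝ) → ℝ) (x : Fin d → ℝ) :
    D Φ i₀ ρ f x = ρ x * jac (Function.update Φ i₀ f) x := by
  rw [D, map_smul, jac_update, smul_eq_mul]

lemma analyticAt_D (h : CofactorFlow K Φ i₀ ρ Fl) {f : (Fin d → ℝ) → ℝ} {x : Fin d → ℝ}
    (hx : x ∈ K) (hf : AnalyticAt ℝ f x) : AnalyticAt ℝ (D Φ i₀ ρ f) x :=
  AnalyticAt.dirDeriv hf ((h.analytic_factor x hx).smul (analyticAt_cofField (h.analytic x hx) i₀))

lemma analyticAt_iterate_D (h : CofactorFlow K Φ i₀ ρ Fl) {f : (Fin d → ℝ) → ℝ} {x : Fin d → ℝ}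
    (hx : x ∈ K) (hf : AnalyticAt ℝ f x) (j : ℕ) : AnalyticAt ℝ ((D Φ i₀ ρ)^[j] f) x := by
  induction j with
  | zero => exact hf
  | succ j ih => rw [Function.iterate_succ_apply']; exact h.analyticAt_D hx ih

lemma hasDerivAt (h : CofactorFlow K Φ i₀ ρ Fl) {f : (Fin d → ℝ) → ℝ}
    (hf : ∀ x ∈ K, AnalyticAt ℝ f x) {x : Fin d → ℝ} (hx : x ∈ K ∧ 0 < ρ x) (t : ℝ) :
    HasDerivAt (fun t => f (Fl x t)) (D Φ i₀ ρ f (Fl x t)) t :=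
  h.flow.hasDerivAt_comp hx t (hf _ (h.flow.mem x hx t).1).differentiableAt

lemma apply_eq_of_ne (h : CofactorFlow K Φ i₀ ρ Fl) {x : Fin d → ℝ} (hx : x ∈ K ∧ 0 < ρ x)
    {i : Fin d} (hi : i ≠ i₀) (t : ℝ) : Φ i (Fl x t) = Φ i x := by
  have hd : ∀ t, HasDerivAt (fun t => Φ i (Fl x t)) 0 t := by
    intro t
    have := h.hasDerivAt (fun x hx => h.analytic x hx i) hx t
    rwa [D, map_smul, fderiv_cofField_of_ne Φ hi, smul_zero] at this
  have := is_const_of_deriv_eq_zero (fun t => (hd t).differentiableAt) (fun t => (hd t).deriv) t 0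
  simpa only [h.flow.zero] using this

lemma exists_order_bound (h : CofactorFlow K Φ i₀ ρ Fl) {f : (Fin d → ℝ) → ℝ}
    (hf : ∀ x ∈ K, AnalyticAt ℝ f x) :
    ∃ N : ℕ, ∀ (x : Fin d → ℝ), (x ∈ K ∧ 0 < ρ x) → (∀ j ≤ N, (D Φ i₀ ρ)^[j] f x = 0) →
      ∀ s, f (Fl x s) = 0 := by
  have hN : ∃ N : ℕ, ∀ p ∈ K, ∃ R ≤ N, ∃ M, ∀ᶠ x in 𝓝 p,
      |(D Φ i₀ ρ)^[R] f x| ≤ M * ∑ j ∈ Finset.range R, |(D Φ i₀ ρ)^[j] f x| := by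
    refine h.compact.induction_on (p := fun S => ∃ N : ℕ, ∀ p ∈ S, ∃ R ≤ N, ∃ M, ∀ᶠ x in 𝓝 p,
      |(D Φ i₀ ρ)^[R] f x| ≤ M * ∑ j ∈ Finset.range R, |(D Φ i₀ ρ)^[j] f x|)
      ⟨0, by simp⟩ (fun S T hST ⟨N, hN⟩ => ⟨N, fun p hp => hN p (hST hp)⟩) ?_ ?_
    · rintro S T ⟨N, hN⟩ ⟨N', hN'⟩
      refine ⟨max N N', fun p hp => hp.elim (fun hp => ?_) fun hp => ?_⟩
      · obtain ⟨R, hR, hM⟩ := hN p hp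
        exact ⟨R, hR.trans (le_max_left _ _), hM⟩
      · obtain ⟨R, hR, hM⟩ := hN' p hp
        exact ⟨R, hR.trans (le_max_right _ _), hM⟩
    · intro p hp
      obtain ⟨R, M, hM⟩ := exists_dominating (fun j => (D Φ i₀ ρ)^[j] f) p
        fun j => h.analyticAt_iterate_D hp (hf p hp) j
      exact ⟨_, nhdsWithin_le_nhds hM.eventually_nhds, R, fun q hq => ⟨R, le_rfl, M, hq⟩⟩
  obtain ⟨N, hN⟩ := hN
  refine ⟨N, fun x hx h0 s => ?_⟩
  have hxt : ∀ t, Fl x t ∈ K := fun t => (h.flow.mem x hx t).1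
  refine eq_zero_of_dominated (u := fun j t => (D Φ i₀ ρ)^[j] f (Fl x t)) (N := N) (t₀ := 0)
    (fun j t => ?_) (fun t => ?_) (fun j hj => ?_) s
  · simp only [Function.iterate_succ_apply']
    exact h.hasDerivAt (fun x hx => h.analyticAt_iterate_D hx (hf x hx) j) hx t
  · obtain ⟨R, hR, M, hM⟩ := hN _ (hxt t)
    exact ⟨R, hR, M, (h.flow.deriv x hx t).continuousAt.eventually hM⟩
  · simpa only [h.flow.zero] using h0 j hj

/-- A uniform bound for the number of zeros of `f` on a level set of the components of `Φ`
different from `i₀`, discarding the orbits on which `f` vanishes identically. -/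
lemma exists_encard_zeros_le (h : CofactorFlow K Φ i₀ ρ Fl) {P : (Fin d → ℝ) → Prop}
    (hT : ∀ f : (Fin d → ℝ) → ℝ, (∀ x ∈ K, AnalyticAt ℝ f x) → ∃ N : ℕ, ∀ y, P y →
      {x | x ∈ K ∧ (∀ i, Function.update Φ i₀ f i x = Function.update y i₀ 0 i) ∧
        jac (Function.update Φ i₀ f) x ≠ 0}.encard ≤ N)
    {f : (Fin d → ℝ) → ℝ} (hf : ∀ x ∈ K, AnalyticAt ℝ f x) :
    ∃ N : ℕ, ∀ y, P y → {c | (c ∈ K ∧ 0 < ρ c) ∧ (∀ i ≠ i₀, Φ i c = y i) ∧ f c = 0 ∧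
      ∃ s, f (Fl c s) ≠ 0}.encard ≤ N := by
  obtain ⟨R, hR⟩ := h.exists_order_bound hf
  choose N hN using fun j => hT ((D Φ i₀ ρ)^[j] f) fun x hx => h.analyticAt_iterate_D hx (hf x hx) j
  refine ⟨∑ j ∈ Finset.range R, N j, fun y hy => ?_⟩
  have key : ∀ n : ℕ, {c | ∃ j < n, c ∈ K ∧
      (∀ i, Function.update Φ i₀ ((D Φ i₀ ρ)^[j] f) i c = Function.update y i₀ 0 i) ∧
        jac (Function.update Φ i₀ ((D Φ i₀ ρ)^[j] f)) c ≠ 0}.encard ≤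
      (∑ j ∈ Finset.range n, N j : ℕ) := by
    intro n
    induction n with
    | zero => simp
    | succ n ih =>
      rw [Finset.sum_range_succ, Nat.cast_add]
      refine (Set.encard_le_encard ?_).trans ((Set.encard_union_le _ _).trans
        (add_le_add ih (hN n y hy)))
      rintro c ⟨j, hj, hc⟩
      rcases Nat.lt_succ_iff_lt_or_eq.1 hj with hj | rfl
      · exact Or.inl ⟨j, hj, hc⟩
      · exact Or.inr hc
  refine (Set.encard_le_encard ?_).trans (key R)
  rintro c ⟨hcG, hcy, hc0, s, hs⟩
  have hex : ∃ j, (D Φ i₀ ρ)^[j] f c ≠ 0 ∧ j ≤ R := by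
    by_contra! hcon
    refine hs (hR c hcG (fun j hj => ?_) s)
    by_contra hne
    exact absurd hj (not_le.2 (hcon j hne))
  classical
  obtain ⟨hm, hmR⟩ := Nat.find_spec hex
  have hmin := fun j => Nat.find_min hex (m := j)
  generalize Nat.find hex = m at hm hmR hmin
  obtain _ | m := m
  · exact absurd hc0 hm
  refine ⟨m, hmR, hcG.1, fun i => ?_, ?_⟩
  · by_cases hi : i = i₀
    · subst hi
      have := hmin m (Nat.lt_succ_self m)
      simp only [Function.update_self]
      by_contra hne
      exact this ⟨hne, by omega⟩
    · simp only [Function.update_of_ne hi]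
      exact hcy i hi
  · rw [Function.iterate_succ_apply', D_eq] at hm
    exact right_ne_zero_of_mul hm

lemma exists_jac_eq_zero (h : CofactorFlow K Φ i₀ ρ Fl) {x : Fin d → ℝ} (hx : x ∈ K ∧ 0 < ρ x)
    {σ a : ℝ} (hσ : σ ≠ 0) (ha : 0 < a) (heq : Φ i₀ (Fl x (σ * a)) = Φ i₀ x) :
    ∃ b, 0 < b ∧ b < a ∧ jac Φ (Fl x (σ * b)) = 0 := by
  have hd : ∀ t, HasDerivAt (fun t => Φ i₀ (Fl x (σ * t)))
      (D Φ i₀ ρ (Φ i₀) (Fl x (σ * t)) * σ) t := by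
    intro t
    have h1 := h.hasDerivAt (fun x hx => h.analytic x hx i₀) hx (σ * t)
    have h2 : HasDerivAt (fun t => σ * t) σ t := by simpa using (hasDerivAt_id t).const_mul σ
    exact HasDerivAt.comp t h1 h2
  obtain ⟨b, ⟨hb0, hba⟩, hb⟩ := exists_hasDerivAt_eq_zero ha
    (fun t _ => (hd t).continuousAt.continuousWithinAt)
    (by simp only [mul_zero, h.flow.zero, heq]) (fun t _ => hd t)
  refine ⟨b, hb0, hba, ?_⟩
  rw [D_eq, Function.update_eq_self] at hb
  have := (h.flow.mem x hx (σ * b)).2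
  have h3 := (mul_eq_zero.1 hb).resolve_right hσ
  exact (mul_eq_zero.1 h3).resolve_left this.ne'

lemma mem_orbit_of_mem_closure (h : CofactorFlow K Φ i₀ ρ Fl) {x p : Fin d → ℝ}
    (hx : x ∈ K ∧ 0 < ρ x) (hp : p ∈ closure (Set.range (Fl x))) (hρ : 0 < ρ p) :
    ∃ s, p = Fl x s := by
  have hpK : p ∈ K := (closure_minimal (by
    rintro _ ⟨t, rfl⟩; exact (h.flow.mem x hx t).1) h.compact.isClosed :
      closure (Set.range (Fl x)) ⊆ K) hp
  have hΦp : ∀ i ≠ i₀, Φ i p = Φ i x := by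
    intro i hi
    by_contra hne
    have h1 : ∀ᶠ q in 𝓝 p, Φ i q ≠ Φ i x :=
      (h.analytic p hpK i).continuousAt.eventually_ne hne
    obtain ⟨q, hq, t, rfl⟩ := mem_closure_iff_nhds.1 hp _ h1
    exact hq (h.apply_eq_of_ne hx hi t)
  have hbox := h.flow.eventually_mem_orbit (Φ := Φ) (fun y hy i => h.analytic y hy.1 i)
    (i₀ := i₀) (ρ := ρ) (fun _ _ => rfl)
    (fun y hy => ((h.analytic_factor y hy.1).smul
      (analyticAt_cofField (h.analytic y hy.1) i₀)).continuousAt)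
    (fun y hy => smul_ne_zero hy.2.ne' (h.ne_zero y hy.1 hy.2))
    (fun y hy i hi t => h.apply_eq_of_ne hy hi t) (p := p) ⟨hpK, hρ⟩
  obtain ⟨q, hq, t, rfl⟩ := mem_closure_iff_nhds.1 hp _ hbox
  obtain ⟨s, hs⟩ := hq fun i hi => by rw [h.apply_eq_of_ne hx hi, hΦp i hi]
  refine ⟨t - s, ?_⟩
  rw [sub_eq_add_neg, ← h.flow.add, hs, h.flow.add, add_neg_cancel, h.flow.zero]

/-- On an orbit without zeros of the Jacobian, the factor `ρ` has a critical point but is not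
constant. -/
lemma exists_critical (h : CofactorFlow K Φ i₀ ρ Fl) {x : Fin d → ℝ} (hx : x ∈ K ∧ 0 < ρ x)
    (hJ : ∀ t, jac Φ (Fl x t) ≠ 0) :
    (∃ s, D Φ i₀ ρ ρ (Fl x s) = 0) ∧ ∃ s, D Φ i₀ ρ ρ (Fl x s) ≠ 0 := by
  have hcl : closure (Set.range (Fl x)) ⊆ K := closure_minimal (by
    rintro _ ⟨t, rfl⟩; exact (h.flow.mem x hx t).1) h.compact.isClosed
  have hcpt : IsCompact (closure (Set.range (Fl x))) := h.compact.of_isClosed_subset isClosed_closure hcl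
  have hne : (closure (Set.range (Fl x))).Nonempty := ⟨_, subset_closure ⟨0, rfl⟩⟩
  have hcrit : ∀ f : (Fin d → ℝ) → ℝ, (∀ x ∈ K, AnalyticAt ℝ f x) →
      (∀ p ∈ closure (Set.range (Fl x)), (∀ q ∈ closure (Set.range (Fl x)), f q ≤ f p) → 0 < ρ p) →
      ∃ s, D Φ i₀ ρ f (Fl x s) = 0 := by
    intro f hf hpos
    obtain ⟨p, hp, hmax⟩ := hcpt.exists_isMaxOn hne
      (f := f) fun y hy => (hf y (hcl hy)).continuousAt.continuousWithinAt
    obtain ⟨s, rfl⟩ := h.mem_orbit_of_mem_closure hx hp (hpos p hp fun q hq => hmax hq)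
    refine ⟨s, ?_⟩
    have hloc : IsLocalMax (fun t => f (Fl x t)) s :=
      Eventually.of_forall fun t => hmax (subset_closure ⟨t, rfl⟩)
    exact hloc.hasDerivAt_eq_zero (h.hasDerivAt hf hx s)
  refine ⟨hcrit ρ h.analytic_factor fun p hp hmax => ?_, ?_⟩
  · have := hmax _ (subset_closure ⟨0, rfl⟩)
    rw [h.flow.zero] at this
    exact hx.2.trans_le this
  · by_contra! hcon
    have hd : ∀ t, HasDerivAt (fun t => ρ (Fl x t)) 0 t := fun t => by
      have := h.hasDerivAt h.analytic_factor hx t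
      rwa [hcon t] at this
    have hconst : ∀ t, ρ (Fl x t) = ρ x := fun t => by
      have := is_const_of_deriv_eq_zero (fun t => (hd t).differentiableAt) (fun t => (hd t).deriv) t 0
      simpa only [h.flow.zero] using this
    obtain ⟨s, hs⟩ := hcrit (Φ i₀) (fun x hx => h.analytic x hx i₀) fun p hp _ => by
      by_contra hneg
      have hne : ρ p ≠ ρ x := fun he => hneg (he ▸ hx.2)
      have h1 : ∀ᶠ q in 𝓝 p, ρ q ≠ ρ x :=
        (h.analytic_factor p (hcl hp)).continuousAt.eventually_ne hne
      obtain ⟨q, hq, t, rfl⟩ := mem_closure_iff_nhds.1 hp _ h1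
      exact hq (hconst t)
    rw [D_eq, Function.update_eq_self] at hs
    exact (mul_ne_zero (h.flow.mem x hx s).2.ne' (hJ s)) hs

end CofactorFlow

end Counting

lemma exists_first_zero {g : ℝ → ℝ} (hg : Continuous g) (h0 : g 0 ≠ 0) (h : ∃ t > 0, g t = 0) :
    ∃ τ > 0, g τ = 0 ∧ ∀ s, 0 < s → s < τ → g s ≠ 0 := by
  let S : Set ℝ := {t | 0 ≤ t ∧ g t = 0}
  have hS : IsClosed S := (isClosed_le continuous_const continuous_id).inter
    (isClosed_eq hg continuous_const)
  have hbdd : BddBelow S := ⟨0, fun t ht => ht.1⟩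
  have hne : S.Nonempty := h.imp fun t ht => ⟨ht.1.le, ht.2⟩
  obtain ⟨h1, h2⟩ := hS.csInf_mem hne hbdd
  refine ⟨sInf S, h1.lt_of_ne fun h3 => h0 (by rw [← h3] at h2; exact h2), h2, fun s hs0 hs hs' => ?_⟩
  exact absurd hs (not_lt.2 (csInf_le hbdd ⟨hs0.le, hs'⟩))

section Counting

variable {d : ℕ}

namespace CofactorFlow

variable {K : Set (Fin d → ℝ)} {Φ : Fin d → (Fin d → ℝ) → ℝ} {i₀ : Fin d}
  {ρ : (Fin d → ℝ) → ℝ} {Fl : (Fin d → ℝ) → ℝ → Fin d → ℝ}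

lemma continuous_jac (h : CofactorFlow K Φ i₀ ρ Fl) {x : Fin d → ℝ} (hx : x ∈ K ∧ 0 < ρ x) :
    Continuous fun t => jac Φ (Fl x t) :=
  continuous_iff_continuousAt.2 fun t =>
    (h.hasDerivAt (fun x hx => analyticAt_jac (h.analytic x hx)) hx t).continuousAt

lemma encard_directed_le (h : CofactorFlow K Φ i₀ ρ Fl) {σ : ℝ} (hσ : σ ≠ 0) (y : Fin d → ℝ) :
    {x | (x ∈ K ∧ 0 < ρ x) ∧ (∀ i, Φ i x = y i) ∧ jac Φ x ≠ 0 ∧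
      ∃ t > 0, jac Φ (Fl x (σ * t)) = 0}.encard ≤
    {c | (c ∈ K ∧ 0 < ρ c) ∧ (∀ i ≠ i₀, Φ i c = y i) ∧ jac Φ c = 0 ∧
      ∃ s, jac Φ (Fl c s) ≠ 0}.encard := by
  have hfirst : ∀ x : Fin d → ℝ, ∃ τ : ℝ, ((x ∈ K ∧ 0 < ρ x) ∧ (∀ i, Φ i x = y i) ∧ jac Φ x ≠ 0 ∧
      ∃ t > 0, jac Φ (Fl x (σ * t)) = 0) → τ > 0 ∧ jac Φ (Fl x (σ * τ)) = 0 ∧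
      ∀ s, 0 < s → s < τ → jac Φ (Fl x (σ * s)) ≠ 0 := by
    intro x
    by_cases hx : (x ∈ K ∧ 0 < ρ x) ∧ (∀ i, Φ i x = y i) ∧ jac Φ x ≠ 0 ∧
      ∃ t > 0, jac Φ (Fl x (σ * t)) = 0
    · obtain ⟨τ, h1, h2⟩ := exists_first_zero (g := fun t => jac Φ (Fl x (σ * t)))
        ((h.continuous_jac hx.1).comp (continuous_const.mul continuous_id))
        (by simpa [h.flow.zero] using hx.2.2.1) hx.2.2.2
      exact ⟨τ, fun _ => ⟨h1, h2⟩⟩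
    · exact ⟨0, fun h => absurd h hx⟩
  choose τ hτ using hfirst
  have aux : ∀ x x' : Fin d → ℝ,
      ((x ∈ K ∧ 0 < ρ x) ∧ (∀ i, Φ i x = y i) ∧ jac Φ x ≠ 0 ∧
        ∃ t > 0, jac Φ (Fl x (σ * t)) = 0) →
      ((x' ∈ K ∧ 0 < ρ x') ∧ (∀ i, Φ i x' = y i) ∧ jac Φ x' ≠ 0 ∧
        ∃ t > 0, jac Φ (Fl x' (σ * t)) = 0) →
      Fl x (σ * τ x) = Fl x' (σ * τ x') → ¬ τ x < τ x' := by
    intro x x' hx hx' he hlt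
    have hxx : x = Fl x' (σ * (τ x' - τ x)) := by
      have := congrArg (fun z => Fl z (-(σ * τ x))) he
      simp only [h.flow.add, add_neg_cancel, h.flow.zero] at this
      refine this.trans ?_
      congr 1; ring
    obtain ⟨b, hb0, hb1, hb⟩ := h.exists_jac_eq_zero hx'.1 hσ (sub_pos.2 hlt)
      (by rw [← hxx, hx.2.1, hx'.2.1])
    exact (hτ x' hx').2.2 b hb0 (hb1.trans (sub_lt_self _ (hτ x hx).1)) hb
  refine Set.encard_le_encard_of_injOn (f := fun x => Fl x (σ * τ x)) ?_ ?_
  · intro x hx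
    refine ⟨h.flow.mem x hx.1 _, fun i hi => ?_, (hτ x hx).2.1, -(σ * τ x), ?_⟩
    · rw [h.apply_eq_of_ne hx.1 hi]; exact hx.2.1 i
    · simp only [h.flow.add, add_neg_cancel, h.flow.zero]
      exact hx.2.2.1
  · intro x hx x' hx' he
    have hτe : τ x = τ x' := le_antisymm (not_lt.1 (aux x' x hx' hx he.symm)) (not_lt.1 (aux x x' hx hx' he))
    have := congrArg (fun z => Fl z (-(σ * τ x))) he
    simp only [h.flow.add, hτe, add_neg_cancel, h.flow.zero] at this
    exact this

lemma encard_regular_le (h : CofactorFlow K Φ i₀ ρ Fl) (y : Fin d → ℝ) :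
    {x | (x ∈ K ∧ 0 < ρ x) ∧ (∀ i, Φ i x = y i) ∧ ∀ t, jac Φ (Fl x t) ≠ 0}.encard ≤
    {c | (c ∈ K ∧ 0 < ρ c) ∧ (∀ i ≠ i₀, Φ i c = y i) ∧ D Φ i₀ ρ ρ c = 0 ∧
      ∃ s, D Φ i₀ ρ ρ (Fl c s) ≠ 0}.encard := by
  have hcrit : ∀ x : Fin d → ℝ, ∃ s : ℝ, ((x ∈ K ∧ 0 < ρ x) ∧ (∀ i, Φ i x = y i) ∧
      ∀ t, jac Φ (Fl x t) ≠ 0) → D Φ i₀ ρ ρ (Fl x s) = 0 := by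
    intro x
    by_cases hx : (x ∈ K ∧ 0 < ρ x) ∧ (∀ i, Φ i x = y i) ∧ ∀ t, jac Φ (Fl x t) ≠ 0
    · obtain ⟨s, hs⟩ := (h.exists_critical hx.1 hx.2.2).1
      exact ⟨s, fun _ => hs⟩
    · exact ⟨0, fun h => absurd h hx⟩
  choose s hs using hcrit
  refine Set.encard_le_encard_of_injOn (f := fun x => Fl x (s x)) ?_ ?_
  · intro x hx
    refine ⟨h.flow.mem x hx.1 _, fun i hi => ?_, hs x hx, ?_⟩
    · rw [h.apply_eq_of_ne hx.1 hi]; exact hx.2.1 i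
    · obtain ⟨t, ht⟩ := (h.exists_critical hx.1 hx.2.2).2
      refine ⟨t - s x, ?_⟩
      rw [h.flow.add, add_sub_cancel]
      exact ht
  · intro x hx x' hx' he
    have hxx : x = Fl x' ((s x' - s x) * 1) := by
      have := congrArg (fun z => Fl z (-(s x))) he
      simp only [h.flow.add, add_neg_cancel, h.flow.zero] at this
      refine this.trans ?_
      congr 1; ring
    by_cases hss : s x' - s x = 0
    · rw [hxx, hss, zero_mul, h.flow.zero]
    · obtain ⟨b, -, -, hb⟩ := h.exists_jac_eq_zero hx'.1 hss one_pos
        (by rw [← hxx, hx.2.1, hx'.2.1])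
      exact absurd hb (hx'.2.2 _)

theorem exists_encard_le (h : CofactorFlow K Φ i₀ ρ Fl) {P : (Fin d → ℝ) → Prop}
    (hT : ∀ f : (Fin d → ℝ) → ℝ, (∀ x ∈ K, AnalyticAt ℝ f x) → ∃ N : ℕ, ∀ y, P y →
      {x | x ∈ K ∧ (∀ i, Function.update Φ i₀ f i x = Function.update y i₀ 0 i) ∧
        jac (Function.update Φ i₀ f) x ≠ 0}.encard ≤ N) :
    ∃ N : ℕ, ∀ y, P y → {x | (x ∈ K ∧ 0 < ρ x) ∧ (∀ i, Φ i x = y i) ∧ jac Φ x ≠ 0}.encard ≤ N := by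
  obtain ⟨N₁, hN₁⟩ := h.exists_encard_zeros_le hT (f := jac Φ)
    fun x hx => analyticAt_jac (h.analytic x hx)
  obtain ⟨N₂, hN₂⟩ := h.exists_encard_zeros_le hT (f := D Φ i₀ ρ ρ)
    fun x hx => h.analyticAt_D hx (h.analytic_factor x hx)
  refine ⟨N₁ + N₁ + N₂, fun y hy => ?_⟩
  push_cast
  refine le_trans ?_ (add_le_add (add_le_add
    ((h.encard_directed_le one_ne_zero y).trans (hN₁ y hy))
    ((h.encard_directed_le (neg_ne_zero.2 one_ne_zero) y).trans (hN₁ y hy)))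
    ((h.encard_regular_le y).trans (hN₂ y hy)))
  refine (Set.encard_le_encard ?_).trans ((Set.encard_union_le _ _).trans
    (add_le_add (Set.encard_union_le _ _) le_rfl))
  rintro x ⟨hx, hxy, hJ⟩
  by_cases hall : ∀ t, jac Φ (Fl x t) ≠ 0
  · exact Or.inr ⟨hx, hxy, hall⟩
  · push Not at hall
    obtain ⟨t, ht⟩ := hall
    refine Or.inl ?_
    rcases lt_trichotomy t 0 with h0 | h0 | h0
    · exact Or.inr ⟨hx, hxy, hJ, -t, neg_pos.2 h0, by simpa using ht⟩
    · rw [h0, h.flow.zero] at ht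
      exact absurd ht hJ
    · exact Or.inl ⟨hx, hxy, hJ, t, h0, by simpa using ht⟩

end CofactorFlow

end Counting

section FiberBound

variable {d : ℕ}

lemma exists_encard_le_of_local {ι X : Type*} [TopologicalSpace X] {K : Set X} (hK : IsCompact K)
    (S : ι → Set X) (P : ι → Prop)
    (hloc : ∀ p ∈ K, ∃ V ∈ 𝓝 p, ∃ N : ℕ, ∀ y, P y → (V ∩ S y).encard ≤ N) :
    ∃ N : ℕ, ∀ y, P y → (K ∩ S y).encard ≤ N := by
  refine hK.induction_on (p := fun A => ∃ N : ℕ, ∀ y, P y → (A ∩ S y).encard ≤ N) ?_ ?_ ?_ ?_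
  · exact ⟨0, fun y _ => by simp⟩
  · rintro A B hAB ⟨N, hN⟩
    exact ⟨N, fun y hy => (Set.encard_le_encard (Set.inter_subset_inter_left _ hAB)).trans (hN y hy)⟩
  · rintro A B ⟨N, hN⟩ ⟨N', hN'⟩
    refine ⟨N + N', fun y hy => ?_⟩
    rw [Set.union_inter_distrib_right, Nat.cast_add]
    exact (Set.encard_union_le _ _).trans (add_le_add (hN y hy) (hN' y hy))
  · intro p hp
    obtain ⟨V, hV, hN⟩ := hloc p hp
    exact ⟨V, nhdsWithin_le_nhds hV, hN⟩

lemma exists_cofactorFlow {Φ : Fin d → (Fin d → ℝ) → ℝ} {p : Fin d → ℝ}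
    (hΦ : ∀ i, AnalyticAt ℝ (Φ i) p) (i₀ : Fin d) :
    ∃ K : Set (Fin d → ℝ), ∃ ρ Fl, CofactorFlow K Φ i₀ ρ Fl ∧
      ∃ V ∈ 𝓝 p, ∀ x ∈ V, jac Φ x ≠ 0 → x ∈ K ∧ 0 < ρ x := by
  have hev : ∀ᶠ x in 𝓝 p, ∀ i, AnalyticAt ℝ (Φ i) x :=
    eventually_all.2 fun i => (hΦ i).eventually_analyticAt
  obtain ⟨ε₀, hε₀, hball⟩ := Metric.eventually_nhds_iff_ball.1 hev
  obtain ⟨ε, hε, hεlt⟩ : ∃ ε > 0, 2 * ε < ε₀ := ⟨ε₀ / 4, by positivity, by linarith⟩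
  have han : ∀ x ∈ Metric.closedBall p (2 * ε), ∀ i, AnalyticAt ℝ (Φ i) x := fun x hx =>
    hball x (Metric.closedBall_subset_ball hεlt hx)
  let b : (Fin d → ℝ) → ℝ := fun x => ε ^ 2 - ∑ i, (x i - p i) ^ 2
  have hbc : Continuous b := by fun_prop
  have hba : ∀ x, AnalyticAt ℝ b x := fun x =>
    analyticAt_const.sub (Finset.analyticAt_fun_sum _ fun i _ =>
      (((ContinuousLinearMap.proj (R := ℝ) (φ := fun _ : Fin d => ℝ) i).analyticAt x).sub
        analyticAt_const).pow 2)
  let K : Set (Fin d → ℝ) := {x | 0 ≤ b x}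
  have hKcl : IsClosed K := isClosed_le continuous_const hbc
  have hKb : K ⊆ Metric.closedBall p ε := by
    intro x hx
    rw [Metric.mem_closedBall, dist_pi_le_iff hε.le]
    intro i
    have h1 : (x i - p i) ^ 2 ≤ ∑ i, (x i - p i) ^ 2 :=
      Finset.single_le_sum (f := fun i => (x i - p i) ^ 2) (fun i _ => sq_nonneg _) (Finset.mem_univ i)
    have h2 : 0 ≤ ε ^ 2 - ∑ i, (x i - p i) ^ 2 := hx
    rw [Real.dist_eq]
    exact abs_le_of_sq_le_sq (by linarith) hε.le
  have hKb2 : K ⊆ Metric.closedBall p (2 * ε) :=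
    hKb.trans (Metric.closedBall_subset_closedBall (by linarith))
  let ρ : (Fin d → ℝ) → ℝ := fun x => b x ^ 2 * ∑ j, cofField Φ i₀ x j ^ 2
  have hρ0 : ∀ x, 0 ≤ ρ x := fun x => mul_nonneg (sq_nonneg _) (Finset.sum_nonneg fun j _ => sq_nonneg _)
  have hρa : ∀ x ∈ Metric.closedBall p (2 * ε), AnalyticAt ℝ ρ x := fun x hx =>
    ((hba x).pow 2).mul (Finset.analyticAt_fun_sum _ fun j _ =>
      (analyticAt_pi_iff.1 (analyticAt_cofField (han x hx) i₀) j).pow 2)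
  have hζa : ∀ x ∈ Metric.closedBall p (2 * ε), AnalyticAt ℝ (fun x => ρ x • cofField Φ i₀ x) x :=
    fun x hx => (hρa x hx).smul (analyticAt_cofField (han x hx) i₀)
  have hbpos : ∀ x, x ∈ K → 0 < ρ x → 0 < b x := by
    intro x hx hρ
    refine lt_of_le_of_ne hx fun h0 => hρ.ne' ?_
    simp [ρ, ← h0]
  have hGo : IsOpen {x | x ∈ K ∧ 0 < ρ x} := by
    refine isOpen_iff_mem_nhds.2 fun x hx => ?_
    have h1 : ∀ᶠ z in 𝓝 x, 0 < b z := hbc.continuousAt.eventually (lt_mem_nhds (hbpos x hx.1 hx.2))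
    have h2 : ∀ᶠ z in 𝓝 x, 0 < ρ z :=
      (hρa x (hKb2 hx.1)).continuousAt.eventually (lt_mem_nhds hx.2)
    filter_upwards [h1, h2] with z hz1 hz2
    exact ⟨hz1.le, hz2⟩
  obtain ⟨Fl, hFl⟩ := exists_orbitFlow (x₀ := p) hε (ζ := fun x => ρ x • cofField Φ i₀ x)
    (fun x hx => (hζa x hx).contDiffAt) hKcl hKb hGo (fun x hx => hx.1) fun x hx hxG => by
      have : ρ x = 0 := le_antisymm (not_lt.1 fun h => hxG ⟨hx, h⟩) (hρ0 x)
      simp [this]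
  refine ⟨K, ρ, Fl, ⟨(isCompact_closedBall p ε).of_isClosed_subset hKcl hKb,
    fun x hx => han x (hKb2 hx), fun x hx => hρa x (hKb2 hx), fun x _ hρ h0 => ?_, hFl⟩,
    {x | 0 < b x}, ?_, ?_⟩
  · simp [ρ, h0] at hρ
  · refine hbc.continuousAt.eventually (lt_mem_nhds ?_)
    simp only [b, sub_self]
    simpa using by positivity
  · intro x hx hJ
    have hx' : 0 < b x := hx
    refine ⟨hx'.le, mul_pos (pow_pos hx' 2) ?_⟩
    obtain ⟨j, hj⟩ : ∃ j, cofField Φ i₀ x j ≠ 0 := by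
      by_contra! hc
      exact cofField_ne_zero hJ i₀ (funext hc)
    exact Finset.sum_pos' (fun j _ => sq_nonneg _) ⟨j, Finset.mem_univ j, by positivity⟩

lemma exists_encard_fiber_le_of_support (T : Finset (Fin d)) :
    ∀ (K : Set (Fin d → ℝ)) (Φ : Fin d → (Fin d → ℝ) → ℝ), IsCompact K →
      (∀ x ∈ K, ∀ i, AnalyticAt ℝ (Φ i) x) → ∃ N : ℕ, ∀ y : Fin d → ℝ, (∀ i ∉ T, y i = 0) →
        (K ∩ {x | (∀ i, Φ i x = y i) ∧ jac Φ x ≠ 0}).encard ≤ N := by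
  induction T using Finset.induction_on with
  | empty =>
    intro K Φ hK hΦ
    refine exists_encard_le_of_local hK _ _ fun p hp => ?_
    have hev := eventually_nhdsWithin_iff.1 (eventually_not_nondegenerate Φ p (hΦ p hp))
    refine ⟨_, hev, 1, fun y hy => ?_⟩
    refine Set.encard_le_one_iff.2 fun a a' ha ha' => ?_
    have hmem : ∀ z : Fin d → ℝ, (z ∈ ({p}ᶜ : Set (Fin d → ℝ)) → ¬((∀ i, Φ i z = 0) ∧ jac Φ z ≠ 0)) →
        ((∀ i, Φ i z = y i) ∧ jac Φ z ≠ 0) → z = p := by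
      intro z h1 h2
      by_contra hne
      exact h1 hne ⟨fun i => (h2.1 i).trans (hy i (by simp)), h2.2⟩
    rw [hmem a ha.1 ha.2, hmem a' ha'.1 ha'.2]
  | insert i₀ T hi₀ ih =>
    intro K Φ hK hΦ
    refine exists_encard_le_of_local hK _ _ fun p hp => ?_
    obtain ⟨K', ρ, Fl, hfl, V, hV, hVK⟩ := exists_cofactorFlow (hΦ p hp) i₀
    obtain ⟨N, hN⟩ := hfl.exists_encard_le (P := fun y => ∀ i ∉ insert i₀ T, y i = 0)
      fun f hf => by
        obtain ⟨N, hN⟩ := ih K' (Function.update Φ i₀ f) hfl.compact fun x hx i => by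
          by_cases hi : i = i₀
          · subst hi; simpa using hf x hx
          · simpa [Function.update_of_ne hi] using hfl.analytic x hx i
        refine ⟨N, fun y hy => hN (Function.update y i₀ 0) fun i hi => ?_⟩
        by_cases hi' : i = i₀
        · subst hi'; simp
        · rw [Function.update_of_ne hi']
          exact hy i (by simp [hi', hi])
    refine ⟨V, hV, N, fun y hy => (Set.encard_le_encard ?_).trans (hN y hy)⟩
    rintro x ⟨hxV, hxy, hJ⟩
    exact ⟨hVK x hxV hJ, hxy, hJ⟩

/-- The number of nondegenerate points in the fibres of an analytic map is bounded on compact sets. -/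
theorem exists_encard_fiber_le {K : Set (Fin d → ℝ)} {Φ : Fin d → (Fin d → ℝ) → ℝ}
    (hK : IsCompact K) (hΦ : ∀ x ∈ K, ∀ i, AnalyticAt ℝ (Φ i) x) :
    ∃ N : ℕ, ∀ y : Fin d → ℝ, (K ∩ {x | (∀ i, Φ i x = y i) ∧ jac Φ x ≠ 0}).encard ≤ N := by
  obtain ⟨N, hN⟩ := exists_encard_fiber_le_of_support Finset.univ K Φ hK hΦ
  exact ⟨N, fun y => hN y fun i hi => absurd (Finset.mem_univ i) hi⟩

end FiberBound

section Area

variable {E : Type*} [NormedAddCommGroup E] [NormedSpace ℝ E] [FiniteDimensional ℝ E]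
  [MeasurableSpace E] [BorelSpace E]

theorem lintegral_abs_det_fderiv_le (μ : Measure E) [μ.IsAddHaarMeasure] {s t : Set E}
    (hs : MeasurableSet s) {f : E → E} (hf : ∀ x ∈ s, HasStrictFDerivAt f (fderiv ℝ f x) x)
    (hdet : ∀ x ∈ s, (fderiv ℝ f x).det ≠ 0) {N : ℕ} (hN : ∀ y, (s ∩ f ⁻¹' {y}).encard ≤ N)
    (ht : MeasurableSet t) (hst : Set.MapsTo f s t) :
    ∫⁻ x in s, ENNReal.ofReal |(fderiv ℝ f x).det| ∂μ ≤ N * μ t := by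
  rcases s.eq_empty_or_nonempty with rfl | hne
  · simp
  have hloc : ∀ x : E, ∃ V : Set E, x ∈ s → IsOpen V ∧ x ∈ V ∧ Set.InjOn f V := by
    intro x
    by_cases hx : x ∈ s
    · have h1 : HasStrictFDerivAt f
          ((fderiv ℝ f x).toContinuousLinearEquivOfDetNeZero (hdet x hx) : E →L[ℝ] E) x := by
        simpa using hf x hx
      obtain ⟨V, hV, hVo, hxV⟩ := eventually_nhds_iff.1 h1.eventually_left_inverse
      refine ⟨V, fun _ => ⟨hVo, hxV, fun a ha b hb hab => ?_⟩⟩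
      rw [← hV a ha, ← hV b hb, hab]
    · exact ⟨∅, fun h => absurd h hx⟩
  choose V hV using hloc
  obtain ⟨A, hAs, hAc, hsA⟩ := TopologicalSpace.countable_cover_nhdsWithin (f := V) (s := s)
    fun x hx => nhdsWithin_le_nhds ((hV x hx).1.mem_nhds (hV x hx).2.1)
  have hAne : A.Nonempty := by
    obtain ⟨x, hx⟩ := hne
    obtain ⟨a, ha, -⟩ := Set.mem_iUnion₂.1 (hsA hx)
    exact ⟨a, ha⟩
  obtain ⟨u, hu⟩ := hAc.exists_eq_range hAne
  have hus : ∀ n, u n ∈ s := fun n => hAs (hu ▸ Set.mem_range_self n)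
  let P : ℕ → Set E := fun n => s ∩ disjointed (fun n => V (u n)) n
  have hPm : ∀ n, MeasurableSet (P n) := fun n =>
    hs.inter (MeasurableSet.disjointed (fun n => (hV _ (hus n)).1.measurableSet) n)
  have hPd : Pairwise (Function.onFun Disjoint P) := fun i j hij =>
    (disjoint_disjointed (fun n => V (u n)) hij).mono Set.inter_subset_right Set.inter_subset_right
  have hPU : ⋃ n, P n = s := by
    rw [← Set.inter_iUnion, iUnion_disjointed, Set.inter_eq_left]
    intro x hx
    obtain ⟨a, ha, hxa⟩ := Set.mem_iUnion₂.1 (hsA hx)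
    rw [hu] at ha
    obtain ⟨n, rfl⟩ := ha
    exact Set.mem_iUnion.2 ⟨n, hxa⟩
  have hPi : ∀ n, Set.InjOn f (P n) := fun n =>
    (hV _ (hus n)).2.2.mono (Set.inter_subset_right.trans (disjointed_subset _ n))
  have hPf : ∀ n, ∀ x ∈ P n, HasFDerivWithinAt f (fderiv ℝ f x) (P n) x := fun n x hx =>
    (hf x hx.1).hasFDerivAt.hasFDerivWithinAt
  have himg : ∀ n, MeasurableSet (f '' P n) := fun n =>
    measurable_image_of_fderivWithin (hPm n) (hPf n) (hPi n)
  calc ∫⁻ x in s, ENNReal.ofReal |(fderiv ℝ f x).det| ∂μ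
      = ∑' n, ∫⁻ x in P n, ENNReal.ofReal |(fderiv ℝ f x).det| ∂μ := by
        rw [← lintegral_iUnion hPm hPd, hPU]
    _ = ∑' n, μ (f '' P n) := by
        congr 1; ext n
        exact lintegral_abs_det_fderiv_eq_addHaar_image μ (hPm n) (hPf n) (hPi n)
    _ = ∑' n, ∫⁻ y, (f '' P n).indicator 1 y ∂μ := by
        congr 1; ext n; rw [lintegral_indicator_one (himg n)]
    _ = ∫⁻ y, ∑' n, (f '' P n).indicator 1 y ∂μ :=
        (lintegral_tsum fun n => (measurable_one.indicator (himg n)).aemeasurable).symm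
    _ ≤ ∫⁻ y, N * t.indicator 1 y ∂μ := by
        refine lintegral_mono fun y => ?_
        by_cases hy : y ∈ t
        · rw [Set.indicator_of_mem hy, Pi.one_apply, mul_one]
          let B : Set ℕ := {n | y ∈ f '' P n}
          have hB : B.encard ≤ N := by
            have hch : ∀ n, ∃ x, n ∈ B → x ∈ P n ∧ f x = y := by
              intro n
              by_cases hn : n ∈ B
              · obtain ⟨x, hx⟩ := hn
                exact ⟨x, fun _ => hx⟩
              · exact ⟨0, fun h => absurd h hn⟩
            choose x hx using hch
            refine (Set.encard_le_encard_of_injOn (f := x) (t := s ∩ f ⁻¹' {y}) ?_ ?_).trans (hN y)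
            · exact fun n hn => ⟨(hx n hn).1.1, (hx n hn).2⟩
            · intro m hm n hn hmn
              by_contra hne
              exact Set.disjoint_left.1 (hPd hne) (hx m hm).1 (hmn ▸ (hx n hn).1)
          have hsum : ∑' n, (f '' P n).indicator (1 : E → ℝ≥0∞) y =
              ∑' n, B.indicator (fun _ => (1 : ℝ≥0∞)) n := by
            refine tsum_congr fun n => ?_
            by_cases hn : y ∈ f '' P n
            · rw [Set.indicator_of_mem hn, Set.indicator_of_mem (show n ∈ B from hn), Pi.one_apply]
            · rw [Set.indicator_of_notMem hn, Set.indicator_of_notMem (show n ∉ B from hn)]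
          change ∑' n, (f '' P n).indicator (1 : E → ℝ≥0∞) y ≤ N
          rw [hsum, ← tsum_subtype, ENNReal.tsum_set_one]
          exact_mod_cast hB
        · rw [Set.indicator_of_notMem hy, mul_zero]
          refine le_of_eq (ENNReal.tsum_eq_zero.2 fun n => Set.indicator_of_notMem ?_ _)
          rintro ⟨x, hx, rfl⟩
          exact hy (hst hx.1)
    _ = N * μ t := by
        rw [lintegral_const_mul' _ _ (by simp), lintegral_indicator_one ht]

end Area

section Admissible

variable {d : ℕ}

lemma pderiv'_coord (j k : Fin d) (x : Fin d → ℝ) :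
    pderiv' k (fun y : Fin d → ℝ => y j) x = (Pi.single k 1 : Fin d → ℝ) j := by
  have : fderiv ℝ (fun y : Fin d → ℝ => y j) x =
      ContinuousLinearMap.proj (R := ℝ) (φ := fun _ : Fin d => ℝ) j :=
    (ContinuousLinearMap.proj (R := ℝ) (φ := fun _ : Fin d => ℝ) j).fderiv
  rw [pderiv', this]; rfl

lemma jac_extend {n : ℕ} {i : Fin n → Fin d} (hi : Function.Injective i)
    (G : Fin n → (Fin d → ℝ) → ℝ) (x : Fin d → ℝ) :
    jac (Function.extend i G fun j y => y j) x =
      (Matrix.of fun r k : Fin n => pderiv' (i r) (G k) x).det := by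
  classical
  let e : Fin n ⊕ ((Set.range i)ᶜ : Set (Fin d)) ≃ Fin d :=
    ((Equiv.ofInjective i hi).sumCongr (Equiv.refl _)).trans (Equiv.Set.sumCompl (Set.range i))
  have hl : ∀ k, e (Sum.inl k) = i k := fun k => by simp [e]
  have hr : ∀ j, e (Sum.inr j) = j := fun j => by simp [e]
  have hEl : ∀ k, Function.extend i G (fun j y => y j) (i k) = G k := fun k => hi.extend_apply _ _ k
  have hEr : ∀ j : ((Set.range i)ᶜ : Set (Fin d)),
      Function.extend i G (fun j y => y j) (j : Fin d) = fun y => y j := fun j =>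
    Function.extend_apply' _ _ _ j.2
  rw [jac, ← Matrix.det_submatrix_equiv_self e]
  have hblock : (jacMat (Function.extend i G fun j y => y j) x).submatrix e e =
      Matrix.fromBlocks (Matrix.of fun r k : Fin n => pderiv' (i r) (G k) x).transpose
        (Matrix.of fun (k : Fin n) (j : ((Set.range i)ᶜ : Set (Fin d))) => pderiv' (j : Fin d) (G k) x)
        0 1 := by
    ext a b
    rcases a with k | j <;> rcases b with k' | j'
    · simp [jacMat, hl, hEl]
    · simp [jacMat, hl, hr, hEl]
    · have : i k' ≠ j := fun h => j.2 ⟨k', h⟩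
      simp [jacMat, hl, hr, hEr, pderiv'_coord, this.symm]
    · simp [jacMat, hr, hEr, pderiv'_coord, Pi.single_apply, Matrix.one_apply, Subtype.ext_iff]
  rw [hblock, Matrix.det_fromBlocks_zero₂₁, Matrix.det_one, mul_one, Matrix.det_transpose]

lemma analyticOnNhd_of_isAdmissible {U : Set (Fin d → ℝ)} (hU : IsOpen U) {F : (Fin d → ℝ) → ℝ}
    (hF : AnalyticOnNhd ℝ F U) {α : ℕ} {β : Fin d → ℕ} {L : ((Fin d → ℝ) → ℝ) → (Fin d → ℝ) → ℝ}
    (hL : IsAdmissible d α β L) : AnalyticOnNhd ℝ (L F) U := by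
  induction hL with
  | id => exact hF
  | det n hn hnd i hi αs βs Ls hLs L hL ih =>
    intro x hx
    have h1 : AnalyticAt ℝ
        (fun x => (Matrix.of fun r k : Fin n => pderiv' (i r) (Ls k F) x).det) x :=
      analyticAt_det fun r k => AnalyticAt.pderiv' (i r) (ih k x hx)
    refine h1.congr ?_
    filter_upwards [hU.mem_nhds hx] with y hy
    exact (hL F y (hF y hy).contDiffAt).symm

lemma sum_single_apply {n : ℕ} {i : Fin n → Fin d} (hi : Function.Injective i) (j : Fin d) :
    (∑ k, Pi.single (i k) 1 : Fin d → ℕ) j = if j ∈ Finset.univ.image i then 1 else 0 := by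
  rw [Finset.sum_apply]
  split_ifs with h
  · obtain ⟨k, -, rfl⟩ := Finset.mem_image.1 h
    rw [Finset.sum_eq_single k]
    · simp
    · intro b _ hb
      exact Pi.single_eq_of_ne (fun h => hb (hi h.symm)) _
    · simp
  · refine Finset.sum_eq_zero fun k _ => Pi.single_eq_of_ne ?_ _
    rintro rfl
    exact h (Finset.mem_image_of_mem i (Finset.mem_univ k))

end Admissible

section Sublevel

variable {d : ℕ}

/-- The part of a sublevel set of `F` inside a box on which `G` is large in a scale-invariant
sense has measure `O(M)`. -/
def HasSublevelBound (D : Set (Fin d → ℝ)) (F G : (Fin d → ℝ) → ℝ) (α : ℕ) (β : Fin d → ℕ)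
    (s : ℕ) : Prop :=
  ∃ C : ℝ, 0 ≤ C ∧ ∀ ε > 0, ∀ A : Fin d → Set ℝ, ∀ a : Fin d → ℝ, (∀ i, MeasurableSet (A i)) →
    (∀ i, 0 < a i) → (∀ i, volume (A i) = ENNReal.ofReal (a i)) → ∀ M > 0,
    volume {x | x ∈ D ∧ (∀ i, x i ∈ A i) ∧ |F x| ≤ ε ∧
      ε ^ α * ∏ i, a i ^ (s - β i) < |G x| * M ^ s} ≤ ENNReal.ofReal (C * M)

lemma measurableSet_abs_le {X : Type*} [TopologicalSpace X] [MeasurableSpace X] [BorelSpace X]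
    {D : Set X} (hD : IsClosed D) {g : X → ℝ} (hg : ContinuousOn g D) (δ : ℝ) :
    MeasurableSet (D ∩ {x | |g x| ≤ δ}) :=
  (hg.abs.preimage_isClosed_of_isClosed hD isClosed_Iic).measurableSet

lemma measurableSet_le_abs {X : Type*} [TopologicalSpace X] [MeasurableSpace X] [BorelSpace X]
    {D : Set X} (hD : IsClosed D) {g : X → ℝ} (hg : ContinuousOn g D) (δ : ℝ) :
    MeasurableSet (D ∩ {x | δ ≤ |g x|}) :=
  (hg.abs.preimage_isClosed_of_isClosed hD isClosed_Ici).measurableSet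

lemma exists_volume_minor_le {D : Set (Fin d → ℝ)} (hD : IsCompact D) {n : ℕ} {i : Fin n → Fin d}
    (hi : Function.Injective i) {G : Fin n → (Fin d → ℝ) → ℝ}
    (hG : ∀ k, ∀ x ∈ D, AnalyticAt ℝ (G k) x) :
    ∃ N : ℕ, ∀ (δ : Fin n → ℝ) (A : Fin d → Set ℝ) (a : Fin d → ℝ) (c : ℝ),
      (∀ k, 0 ≤ δ k) → (∀ i, MeasurableSet (A i)) → (∀ i, 0 < a i) →
      (∀ i, volume (A i) = ENNReal.ofReal (a i)) → 0 < c →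
      ENNReal.ofReal c * volume {x | x ∈ D ∧ (∀ i, x i ∈ A i) ∧ (∀ k, |G k x| ≤ δ k) ∧
        c ≤ |(Matrix.of fun r k : Fin n => pderiv' (i r) (G k) x).det|} ≤
      N * ENNReal.ofReal ((∏ k, (2 * δ k)) * ∏ j ∈ (Finset.univ.image i)ᶜ, a j) := by
  let H : Fin d → (Fin d → ℝ) → ℝ := Function.extend i G fun j y => y j
  have hHl : ∀ k, H (i k) = G k := fun k => hi.extend_apply _ _ k
  have hHr : ∀ j, j ∉ Finset.univ.image i → H j = fun y => y j := fun j hj =>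
    Function.extend_apply' _ _ _ (by simpa using hj)
  have hHa : ∀ x ∈ D, ∀ j, AnalyticAt ℝ (H j) x := by
    intro x hx j
    by_cases hj : j ∈ Finset.univ.image i
    · obtain ⟨k, -, rfl⟩ := Finset.mem_image.1 hj
      rw [hHl]; exact hG k x hx
    · rw [hHr j hj]
      exact (ContinuousLinearMap.proj (R := ℝ) (φ := fun _ : Fin d => ℝ) j).analyticAt x
  have hjac : ∀ x, jac H x = (Matrix.of fun r k : Fin n => pderiv' (i r) (G k) x).det :=
    jac_extend hi G
  obtain ⟨N, hN⟩ := exists_encard_fiber_le hD hHa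
  refine ⟨N, fun δ A a c hδ hA ha hAa hc => ?_⟩
  simp only [← hjac]
  set W : Set (Fin d → ℝ) := {x | x ∈ D ∧ (∀ i, x i ∈ A i) ∧ (∀ k, |G k x| ≤ δ k) ∧ c ≤ |jac H x|}
    with hWdef
  have hWm : MeasurableSet W := by
    have h1 : MeasurableSet (D ∩ {x | c ≤ |jac H x|}) := measurableSet_le_abs hD.isClosed
      (fun x hx => (analyticAt_jac (hHa x hx)).continuousAt.continuousWithinAt) c
    have h2 : ∀ k, MeasurableSet (D ∩ {x | |G k x| ≤ δ k}) := fun k =>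
      measurableSet_abs_le hD.isClosed
        (fun x hx => (hG k x hx).continuousAt.continuousWithinAt) (δ k)
    have h3 : ∀ j, MeasurableSet {x : Fin d → ℝ | x j ∈ A j} := fun j => measurable_pi_apply j (hA j)
    have : W = (D ∩ {x | c ≤ |jac H x|}) ∩ (⋂ j, {x : Fin d → ℝ | x j ∈ A j}) ∩
        ⋂ k, ({x | x ∉ D} ∪ (D ∩ {x | |G k x| ≤ δ k})) := by
      ext x
      simp only [hWdef, Set.mem_ofPred_eq, Set.mem_inter_iff, Set.mem_iInter, Set.mem_union]
      constructor
      · rintro ⟨h1, h2, h3, h4⟩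
        exact ⟨⟨⟨h1, h4⟩, h2⟩, fun k => Or.inr ⟨h1, h3 k⟩⟩
      · rintro ⟨⟨⟨h1, h4⟩, h2⟩, h3⟩
        exact ⟨h1, h2, fun k => ((h3 k).resolve_left fun h => h h1).2, h4⟩
    rw [this]
    exact (h1.inter (MeasurableSet.iInter h3)).inter (MeasurableSet.iInter fun k =>
      hD.measurableSet.compl.union (h2 k))
  let T : Fin d → Set ℝ := Function.extend i (fun k => Set.Icc (-δ k) (δ k)) A
  have hTl : ∀ k, T (i k) = Set.Icc (-δ k) (δ k) := fun k => hi.extend_apply _ _ k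
  have hTr : ∀ j, j ∉ Finset.univ.image i → T j = A j := fun j hj =>
    Function.extend_apply' _ _ _ (by simpa using hj)
  have hTm : MeasurableSet (Set.univ.pi T) := by
    refine MeasurableSet.univ_pi fun j => ?_
    by_cases hj : j ∈ Finset.univ.image i
    · obtain ⟨k, -, rfl⟩ := Finset.mem_image.1 hj
      rw [hTl]; exact measurableSet_Icc
    · rw [hTr j hj]; exact hA j
  have hTv : volume (Set.univ.pi T) =
      ENNReal.ofReal ((∏ k, (2 * δ k)) * ∏ j ∈ (Finset.univ.image i)ᶜ, a j) := by
    have hδ2 : ∀ k, 0 ≤ 2 * δ k := fun k => mul_nonneg zero_le_two (hδ k)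
    rw [volume_pi_pi, ← Finset.prod_mul_prod_compl (Finset.univ.image i),
      Finset.prod_image fun _ _ _ _ h => hi h,
      ENNReal.ofReal_mul (Finset.prod_nonneg fun k _ => hδ2 k),
      ENNReal.ofReal_prod_of_nonneg fun k _ => hδ2 k,
      ENNReal.ofReal_prod_of_nonneg fun j _ => (ha j).le]
    congr 1
    · refine Finset.prod_congr rfl fun k _ => ?_
      rw [hTl, Real.volume_Icc]; congr 1; ring
    · refine Finset.prod_congr rfl fun j hj => ?_
      rw [hTr j (Finset.mem_compl.1 hj), hAa]
  have hdf : ∀ x ∈ W, ∀ j, DifferentiableAt ℝ (H j) x := fun x hx j =>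
    (hHa x hx.1 j).differentiableAt
  have hdet : ∀ x ∈ W, (fderiv ℝ (fun y j => H j y) x).det = jac H x := fun x hx =>
    det_fderiv_eq_jac (hdf x hx)
  have hjne : ∀ x ∈ W, jac H x ≠ 0 := fun x hx => abs_pos.1 (hc.trans_le hx.2.2.2)
  have hmaps : Set.MapsTo (fun y j => H j y) W (Set.univ.pi T) := by
    intro x hx j _
    by_cases hj : j ∈ Finset.univ.image i
    · obtain ⟨k, -, rfl⟩ := Finset.mem_image.1 hj
      rw [hTl]
      simp only [hHl]
      exact abs_le.1 (hx.2.2.1 k)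
    · rw [hTr j hj]
      simp only [hHr j hj]
      exact hx.2.1 j
  have harea := lintegral_abs_det_fderiv_le volume hWm (f := fun y j => H j y)
    (fun x hx => (AnalyticAt.pi (hHa x hx.1)).hasStrictFDerivAt)
    (fun x hx => by rw [hdet x hx]; exact hjne x hx) (N := N)
    (fun y => (Set.encard_le_encard
      (t := D ∩ {x | (∀ j, H j x = y j) ∧ jac H x ≠ 0}) fun x hx =>
      ⟨hx.1.1, fun j => congrFun hx.2 j, hjne x hx.1⟩).trans (hN y)) hTm hmaps
  rw [hTv] at harea
  refine le_trans ?_ harea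
  rw [← setLIntegral_const]
  refine setLIntegral_mono' hWm fun x hx => ?_
  rw [hdet x hx]
  exact ENNReal.ofReal_le_ofReal hx.2.2.2

end Sublevel

section Sublevel

variable {d : ℕ}

lemma prod_scale_identity {n : ℕ} (I : Finset (Fin d)) (αs s : Fin n → ℕ) (βs : Fin n → Fin d → ℕ)
    (hβ : ∀ k j, βs k j ≤ s k) (ε M : ℝ) (hM : 0 < M) (a : Fin d → ℝ) :
    (∏ k, (2 * (ε ^ αs k * (∏ j, a j ^ (s k - βs k j)) / M ^ s k))) * ∏ j ∈ Iᶜ, a j =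
      2 ^ n * (ε ^ (∑ k, αs k) *
        (∏ j, a j ^ (∑ k, s k + 1 - (∑ k, βs k j + if j ∈ I then 1 else 0))) /
          M ^ (∑ k, s k + 1) * M) := by
  have h1 : ∀ j, ∑ k, s k + 1 - (∑ k, βs k j + if j ∈ I then 1 else 0) =
      ∑ k, (s k - βs k j) + if j ∈ I then 0 else 1 := by
    intro j
    have h2 : ∑ k, (s k - βs k j) + ∑ k, βs k j = ∑ k, s k := by
      rw [← Finset.sum_add_distrib]
      exact Finset.sum_congr rfl fun k _ => Nat.sub_add_cancel (hβ k j)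
    split_ifs <;> omega
  have h3 : ∏ j ∈ Iᶜ, a j = ∏ j, a j ^ (if j ∈ I then 0 else 1) := by
    rw [← Finset.prod_mul_prod_compl I (fun j => a j ^ (if j ∈ I then 0 else 1))]
    rw [Finset.prod_eq_one (s := I) fun j hj => by simp [hj], one_mul]
    exact Finset.prod_congr rfl fun j hj => by simp [Finset.mem_compl.1 hj]
  simp only [h1, h3, pow_add, Finset.prod_mul_distrib, ← Finset.prod_pow_eq_pow_sum,
    Finset.prod_div_distrib, Finset.prod_const, Finset.card_univ, Fintype.card_fin, pow_one]
  rw [Finset.prod_comm]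
  have hM' : ∏ k, M ^ s k ≠ 0 := Finset.prod_ne_zero_iff.2 fun k _ => (pow_pos hM _).ne'
  field_simp

theorem exists_hasSublevelBound {U D : Set (Fin d → ℝ)} (hU : IsOpen U) {F : (Fin d → ℝ) → ℝ}
    (hF : AnalyticOnNhd ℝ F U) (hD : IsCompact D) (hDU : D ⊆ U) {α : ℕ} {β : Fin d → ℕ}
    {L : ((Fin d → ℝ) → ℝ) → (Fin d → ℝ) → ℝ} (hL : IsAdmissible d α β L) :
    ∃ s : ℕ, s + α = ∑ i, β i + 1 ∧ (∀ i, β i ≤ s) ∧ ((α = 1 ∧ β = 0) ∨ 1 ≤ s) ∧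
      HasSublevelBound D F (L F) α β s := by
  induction hL with
  | id =>
    refine ⟨0, by simp, by simp, Or.inl ⟨rfl, rfl⟩, 0, le_rfl, fun ε hε A a hA ha hAa M hM => ?_⟩
    refine le_of_eq_of_le ?_ zero_le
    convert measure_empty (μ := volume)
    refine Set.eq_empty_of_forall_notMem fun x hx => ?_
    have h1 := hx.2.2.1
    have h2 := hx.2.2.2
    simp only [pow_one, zero_tsub, pow_zero, Finset.prod_const_one, mul_one] at h2
    exact absurd h2 (not_lt.2 h1)
  | det n hn hnd i hi αs βs Ls hLs L hL ih =>
    choose s hs1 hs2 hs3 hs4 using ih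
    choose C hC0 hC using hs4
    obtain ⟨N, hN⟩ := exists_volume_minor_le hD hi (G := fun k => Ls k F) fun k x hx =>
      analyticOnNhd_of_isAdmissible hU hF (hLs k) x (hDU hx)
    have hβj : ∀ j, ((∑ k, βs k) + ∑ k, Pi.single (i k) 1 : Fin d → ℕ) j =
        ∑ k, βs k j + if j ∈ Finset.univ.image i then 1 else 0 := fun j => by
      rw [Pi.add_apply, sum_single_apply hi, Finset.sum_apply]
    refine ⟨∑ k, s k + 1, ?_, ?_, Or.inr (by omega), ∑ k, C k + N * 2 ^ n,
      by have := Finset.sum_nonneg fun k (_ : k ∈ Finset.univ) => hC0 k; positivity,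
      fun ε hε A a hA ha hAa M hM => ?_⟩
    · simp only [hβj, Finset.sum_add_distrib]
      rw [Finset.sum_comm (f := fun j k => βs k j)]
      have h1 : ∑ j, (if j ∈ Finset.univ.image i then 1 else 0) = n := by
        simp [Finset.card_image_of_injective _ hi]
      have h2 : ∑ k, s k + ∑ k, αs k = ∑ k, ∑ j, βs k j + n := by
        rw [← Finset.sum_add_distrib, Finset.sum_congr rfl fun k _ => hs1 k, Finset.sum_add_distrib]
        simp
      omega
    · intro j
      rw [hβj]
      have : ∑ k, βs k j ≤ ∑ k, s k := Finset.sum_le_sum fun k _ => hs2 k j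
      split_ifs <;> omega
    · simp only [hβj]
      set δ : Fin n → ℝ := fun k => ε ^ αs k * (∏ j, a j ^ (s k - βs k j)) / M ^ s k with hδ
      set c : ℝ := ε ^ (∑ k, αs k) *
        (∏ j, a j ^ (∑ k, s k + 1 - (∑ k, βs k j + if j ∈ Finset.univ.image i then 1 else 0))) /
          M ^ (∑ k, s k + 1) with hc
      have hδ0 : ∀ k, 0 ≤ δ k := fun k => by
        have := Finset.prod_pos fun j (_ : j ∈ Finset.univ) => pow_pos (ha j) (s k - βs k j)
        positivity
      have hc0 : 0 < c := by
        have := Finset.prod_pos fun j (_ : j ∈ Finset.univ) => pow_pos (ha j)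
          (∑ k, s k + 1 - (∑ k, βs k j + if j ∈ Finset.univ.image i then 1 else 0))
        positivity
      set W : Set (Fin d → ℝ) := {x | x ∈ D ∧ (∀ i, x i ∈ A i) ∧ (∀ k, |Ls k F x| ≤ δ k) ∧
        c ≤ |(Matrix.of fun r k : Fin n => pderiv' (i r) (Ls k F) x).det|}
      have hW : volume W ≤ ENNReal.ofReal (N * 2 ^ n * M) := by
        have h1 := hN δ A a c hδ0 hA ha hAa hc0
        rw [hδ, prod_scale_identity _ αs s βs hs2 ε M hM a, ← hc] at h1
        have hcne : ENNReal.ofReal c ≠ 0 := (ENNReal.ofReal_pos.2 hc0).ne'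
        refine (ENNReal.mul_le_mul_iff_right hcne ENNReal.ofReal_ne_top).1 (h1.trans_eq ?_)
        rw [← ENNReal.ofReal_natCast, ← ENNReal.ofReal_mul (by positivity),
          ← ENNReal.ofReal_mul hc0.le]
        congr 1
        ring
      let Z : Fin n → Set (Fin d → ℝ) := fun k => {x | x ∈ D ∧ (∀ i, x i ∈ A i) ∧ |F x| ≤ ε ∧
        ε ^ αs k * ∏ i, a i ^ (s k - βs k i) < |Ls k F x| * M ^ s k}
      have hZ : ∀ k, volume (Z k) ≤ ENNReal.ofReal (C k * M) := fun k =>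
        hC k ε hε A a hA ha hAa M hM
      calc volume _ ≤ volume ((⋃ k, Z k) ∪ W) := by
            refine measure_mono ?_
            rintro x ⟨hxD, hxA, hxF, hx⟩
            by_cases hk : ∃ k, ε ^ αs k * ∏ i, a i ^ (s k - βs k i) < |Ls k F x| * M ^ s k
            · obtain ⟨k, hk⟩ := hk
              exact Or.inl (Set.mem_iUnion.2 ⟨k, hxD, hxA, hxF, hk⟩)
            · push Not at hk
              refine Or.inr ⟨hxD, hxA, fun k => (le_div_iff₀ (by positivity)).2 (hk k), ?_⟩
              rw [← hL F x (hF x (hDU hxD)).contDiffAt]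
              exact (div_le_iff₀ (by positivity)).2 hx.le
        _ ≤ ∑ k, volume (Z k) + volume W :=
            (measure_union_le _ _).trans (add_le_add (measure_iUnion_fintype_le _ _) le_rfl)
        _ ≤ ∑ k, ENNReal.ofReal (C k * M) + ENNReal.ofReal (N * 2 ^ n * M) :=
            add_le_add (Finset.sum_le_sum fun k _ => hZ k) hW
        _ = ENNReal.ofReal ((∑ k, C k + N * 2 ^ n) * M) := by
            rw [← ENNReal.ofReal_sum_of_nonneg fun k _ => mul_nonneg (hC0 k) hM.le,
              ← ENNReal.ofReal_add (Finset.sum_nonneg fun k _ => mul_nonneg (hC0 k) hM.le)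
                (by positivity), ← Finset.sum_mul, add_mul]

end Sublevel

section Lorentz

lemma lintegral_prod_pi {d : ℕ} (g : Fin d → ℝ → ℝ≥0∞) (hg : ∀ i, Measurable (g i)) :
    ∫⁻ x : Fin d → ℝ, ∏ i, g i (x i) = ∏ i, ∫⁻ t, g i t := by
  induction d with
  | zero => simp [volume_pi]
  | succ d ih =>
    have hmp := (volume_preserving_piFinSuccAbove (fun _ : Fin (d + 1) => ℝ) 0).symm
    rw [← hmp.lintegral_comp_emb (MeasurableEquiv.measurableEmbedding _), Fin.prod_univ_succ,
      ← ih _ fun i => hg i.succ, Measure.volume_eq_prod, ← lintegral_prod_mul (hg 0).aemeasurable]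
    · refine lintegral_congr fun z => ?_
      rw [Fin.prod_univ_succ]
      simp [MeasurableEquiv.piFinSuccAbove_symm_apply]
    · exact (Finset.measurable_prod _ fun i _ => (hg i.succ).comp (measurable_pi_apply i)).aemeasurable

variable {d : ℕ}

/-- The power `v ^ ρ` with the convention that the `0`-th power is the indicator of `v ≠ 0`. -/
noncomputable def strictPow (ρ : ℝ) (v : ℝ≥0∞) : ℝ≥0∞ := if v = 0 then 0 else v ^ ρ

lemma measurable_strictPow (ρ : ℝ) : Measurable (strictPow ρ) :=
  Measurable.ite (measurableSet_singleton 0) measurable_const (measurable_id.pow_const ρ)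

lemma lintegral_strictPow_le {ρ : ℝ} (hρ : 0 ≤ ρ) (f : ℝ → ℝ) :
    ∫⁻ s, (Set.Ioi (0 : ℝ)).indicator (fun s => strictPow ρ (volume {t : ℝ | s < |f t|})) s ≤
      lorentzNorm₁ ρ f := by
  rw [lintegral_indicator measurableSet_Ioi, lorentzNorm₁]
  split_ifs with h
  · subst h
    have hset : MeasurableSet {s : ℝ | ENNReal.ofReal s ≤ eLpNormEssSup f volume} :=
      measurableSet_le ENNReal.measurable_ofReal measurable_const
    calc ∫⁻ s in Set.Ioi (0 : ℝ), strictPow 0 (volume {t : ℝ | s < |f t|})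
        ≤ ∫⁻ s in Set.Ioi (0 : ℝ),
            {s : ℝ | ENNReal.ofReal s ≤ eLpNormEssSup f volume}.indicator 1 s := by
          refine setLIntegral_mono' measurableSet_Ioi fun s hs => ?_
          by_cases h : ENNReal.ofReal s ≤ eLpNormEssSup f volume
          · rw [Set.indicator_of_mem (show s ∈ {s : ℝ | ENNReal.ofReal s ≤ eLpNormEssSup f volume} from h), strictPow]
            split_ifs <;> simp
          · have h0 : volume {t : ℝ | s < |f t|} = 0 := by
              refine measure_mono_null (fun t ht => ?_) (meas_eLpNormEssSup_lt (f := f) (μ := volume))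
              change eLpNormEssSup f volume < ‖f t‖ₑ
              refine (not_le.1 h).trans ?_
              rw [Real.enorm_eq_ofReal_abs]
              exact (ENNReal.ofReal_lt_ofReal_iff_of_nonneg (le_of_lt hs)).2 ht
            rw [strictPow, if_pos h0]
            exact zero_le
      _ = volume ({s : ℝ | ENNReal.ofReal s ≤ eLpNormEssSup f volume} ∩ Set.Ioi 0) := by
          rw [lintegral_indicator_one hset, Measure.restrict_apply hset]
      _ ≤ eLpNormEssSup f volume := by
          by_cases htop : eLpNormEssSup f volume = ⊤
          · rw [htop]; exact le_top
          · refine (measure_mono (t := Set.Ioc 0 (eLpNormEssSup f volume).toReal) ?_).trans ?_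
            · intro s hs
              exact ⟨hs.2, (ENNReal.ofReal_le_iff_le_toReal htop).1 hs.1⟩
            · rw [Real.volume_Ioc, sub_zero, ENNReal.ofReal_toReal htop]
      _ = eLpNorm f ⊤ volume := eLpNorm_exponent_top.symm
  · refine setLIntegral_mono' measurableSet_Ioi fun s _ => ?_
    rw [strictPow]
    split_ifs
    · exact zero_le
    · exact le_rfl

/-- A restricted multilinear estimate on boxes upgrades to Lorentz spaces. -/
lemma lintegral_prod_le_of_box {S : Set (Fin d → ℝ)} {B : ℝ≥0∞} {ρ : Fin d → ℝ}
    (hρ : ∀ i, 0 ≤ ρ i)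
    (hbox : ∀ A : Fin d → Set ℝ, (∀ i, MeasurableSet (A i)) →
      volume (S ∩ {x | ∀ i, x i ∈ A i}) ≤ B * ∏ i, strictPow (ρ i) (volume (A i)))
    {f : Fin d → ℝ → ℝ} (hf : ∀ i, Measurable (f i)) :
    ∫⁻ x in S, ∏ i, ‖f i (x i)‖ₑ ≤ B * ∏ i, lorentzNorm₁ (ρ i) (f i) := by
  let Q : Set ((Fin d → ℝ) × (Fin d → ℝ)) := {z | ∀ i, 0 < z.2 i ∧ z.2 i < |f i (z.1 i)|}
  have hQ : MeasurableSet Q := by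
    have : Q = ⋂ i, ({z | 0 < z.2 i} ∩ {z | z.2 i < |f i (z.1 i)|}) := by
      ext z; simp [Q]
    rw [this]
    refine MeasurableSet.iInter fun i => ?_
    have h2 : Measurable fun z : (Fin d → ℝ) × (Fin d → ℝ) => z.2 i :=
      (measurable_pi_apply i).comp measurable_snd
    have h1 : Measurable fun z : (Fin d → ℝ) × (Fin d → ℝ) => |f i (z.1 i)| :=
      ((hf i).comp ((measurable_pi_apply i).comp measurable_fst)).abs
    exact (measurableSet_lt measurable_const h2).inter (measurableSet_lt h2 h1)
  have hAm : ∀ i (s : ℝ), MeasurableSet {t : ℝ | s < |f i t|} := fun i s =>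
    measurableSet_lt measurable_const (hf i).abs
  have hmono : ∀ i, Antitone fun s : ℝ => volume {t : ℝ | s < |f i t|} := fun i s s' hs =>
    measure_mono fun t ht => lt_of_le_of_lt hs ht
  let φ : Fin d → ℝ → ℝ≥0∞ := fun i => (Set.Ioi (0 : ℝ)).indicator
    fun s => strictPow (ρ i) (volume {t : ℝ | s < |f i t|})
  have hφ : ∀ i, Measurable (φ i) := fun i =>
    ((measurable_strictPow (ρ i)).comp (hmono i).measurable).indicator measurableSet_Ioi
  calc ∫⁻ x in S, ∏ i, ‖f i (x i)‖ₑ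
      = ∫⁻ x in S, volume (Prod.mk x ⁻¹' Q) := by
        refine lintegral_congr fun x => ?_
        have : Prod.mk x ⁻¹' Q = Set.univ.pi fun i => Set.Ioo 0 |f i (x i)| := by
          ext s; simp [Q]
        rw [this, volume_pi_pi]
        refine Finset.prod_congr rfl fun i _ => ?_
        rw [Real.volume_Ioo, sub_zero, Real.enorm_eq_ofReal_abs]
    _ = ∫⁻ s, (volume.restrict S) ((fun x => (x, s)) ⁻¹' Q) := by
        rw [← Measure.prod_apply hQ, Measure.prod_apply_symm hQ]
    _ ≤ ∫⁻ s : Fin d → ℝ, B * ∏ i, φ i (s i) := by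
        refine lintegral_mono fun s => ?_
        have hsec : MeasurableSet ((fun x => (x, s)) ⁻¹' Q) := measurable_prodMk_right hQ
        rw [Measure.restrict_apply hsec]
        by_cases hs : ∀ i, 0 < s i
        · have h1 : ∀ i, φ i (s i) = strictPow (ρ i) (volume {t : ℝ | s i < |f i t|}) := fun i =>
            Set.indicator_of_mem (hs i) _
          simp only [h1]
          refine (measure_mono ?_).trans (hbox (fun i => {t : ℝ | s i < |f i t|}) fun i => hAm i _)
          rintro x ⟨hx, hxS⟩
          exact ⟨hxS, fun i => (hx i).2⟩
        · push Not at hs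
          obtain ⟨i, hi⟩ := hs
          refine le_of_eq_of_le ?_ zero_le
          convert measure_empty (μ := (volume : Measure (Fin d → ℝ)))
          refine Set.eq_empty_of_forall_notMem fun x hx => ?_
          exact absurd (hx.1 i).1 (not_lt.2 hi)
    _ = B * ∏ i, ∫⁻ s, φ i s := by
        have hm : Measurable fun s : Fin d → ℝ => ∏ i, φ i (s i) :=
          Finset.measurable_prod _ fun i _ => (hφ i).comp (measurable_pi_apply i)
        rw [lintegral_const_mul _ hm, lintegral_prod_pi φ hφ]
    _ ≤ B * ∏ i, lorentzNorm₁ (ρ i) (f i) :=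
        mul_le_mul_right (Finset.prod_le_prod' fun i _ => lintegral_strictPow_le (hρ i) (f i)) _

end Lorentz

section Assembly

variable {d : ℕ}

lemma strictPow_mono {ρ : ℝ} (hρ : 0 ≤ ρ) : Monotone (strictPow ρ) := by
  intro v w h
  unfold strictPow
  by_cases hv : v = 0
  · simp [hv]
  · have hw : w ≠ 0 := fun hw => hv (nonpos_iff_eq_zero.1 (hw ▸ h))
    rw [if_neg hv, if_neg hw]
    exact ENNReal.rpow_le_rpow h hρ

lemma volume_sublevel_inter_box_le {D : Set (Fin d → ℝ)} {F G : (Fin d → ℝ) → ℝ} {α : ℕ}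
    {β : Fin d → ℕ} {s : ℕ} (hD : IsCompact D) (hs : 1 ≤ s) (hβ : ∀ i, β i ≤ s)
    (h : HasSublevelBound D F G α β s) :
    ∃ K : ℝ, ∀ c : ℝ, 0 < c → (∀ x ∈ D, c ≤ |G x|) → ∀ ε : ℝ, 0 < ε →
      ∀ A : Fin d → Set ℝ, (∀ i, MeasurableSet (A i)) →
        volume ({x | x ∈ D ∧ |F x| ≤ ε} ∩ {x | ∀ i, x i ∈ A i}) ≤
          ENNReal.ofReal (K * ε ^ ((α : ℝ) / s) * c ^ (-(1 : ℝ) / s)) *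
            ∏ i, strictPow (1 - (β i : ℝ) / s) (volume (A i)) := by
  obtain ⟨C, hC, hbound⟩ := h
  obtain ⟨R, hR⟩ := hD.isBounded.subset_closedBall 0
  have hs0 : (0 : ℝ) < s := by exact_mod_cast hs
  have hsn : s ≠ 0 := by omega
  have hρ : ∀ i, 0 ≤ 1 - (β i : ℝ) / s := fun i => by
    rw [sub_nonneg, div_le_one hs0]
    exact_mod_cast hβ i
  refine ⟨2 * C, fun c hc hcG ε hε A hA => ?_⟩
  let A' : Fin d → Set ℝ := fun i => A i ∩ Set.Icc (-R) R
  have hA' : ∀ i, MeasurableSet (A' i) := fun i => (hA i).inter measurableSet_Icc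
  have hfin : ∀ i, volume (A' i) ≠ ⊤ := fun i =>
    ((measure_mono Set.inter_subset_right).trans_lt isCompact_Icc.measure_lt_top).ne
  have hmem : ∀ x ∈ D, ∀ i, x i ∈ A i → x i ∈ A' i := fun x hx i hxi => by
    refine ⟨hxi, abs_le.1 ?_⟩
    have h1 : ‖x‖ ≤ R := by simpa using hR hx
    exact (norm_le_pi_norm x i).trans h1
  by_cases hz : ∃ i, volume (A' i) = 0
  · obtain ⟨i, hi⟩ := hz
    refine le_of_eq_of_le (measure_mono_null (t := Function.eval i ⁻¹' A' i) ?_ ?_) zero_le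
    · rintro x ⟨hx, hxA⟩
      exact hmem x hx.1 i (hxA i)
    · rw [volume_pi]
      exact Measure.pi_eval_preimage_null _ hi
  push Not at hz
  have ha : ∀ i, 0 < (volume (A' i)).toReal := fun i => ENNReal.toReal_pos (hz i) (hfin i)
  set a : Fin d → ℝ := fun i => (volume (A' i)).toReal with ha_def
  have haA : ∀ i, volume (A' i) = ENNReal.ofReal (a i) := fun i =>
    (ENNReal.ofReal_toReal (hfin i)).symm
  set P : ℝ := ∏ i, a i ^ (1 - (β i : ℝ) / s) with hP
  have hPpos : 0 < P := Finset.prod_pos fun i _ => Real.rpow_pos_of_pos (ha i) _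
  have hεp : 0 < ε ^ ((α : ℝ) / s) := Real.rpow_pos_of_pos hε _
  have hcp : 0 < c ^ (-(1 : ℝ) / s) := Real.rpow_pos_of_pos hc _
  set M : ℝ := ε ^ ((α : ℝ) / s) * c ^ (-(1 : ℝ) / s) * P with hM
  have hMpos : 0 < M := by positivity
  have hεs : (ε ^ ((α : ℝ) / s)) ^ s = ε ^ α := by
    rw [← Real.rpow_mul_natCast hε.le, div_mul_cancel₀ _ hs0.ne', Real.rpow_natCast]
  have hcs : (c ^ (-(1 : ℝ) / s)) ^ s = c⁻¹ := by
    rw [← Real.rpow_mul_natCast hc.le, div_mul_cancel₀ _ hs0.ne', Real.rpow_neg_one]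
  have hPs : P ^ s = ∏ i, a i ^ (s - β i) := by
    rw [hP, ← Finset.prod_pow]
    refine Finset.prod_congr rfl fun i _ => ?_
    rw [← Real.rpow_mul_natCast (ha i).le, ← Real.rpow_natCast, Nat.cast_sub (hβ i)]
    congr 1
    field_simp
  have hcM : c * M ^ s = ε ^ α * ∏ i, a i ^ (s - β i) := by
    rw [hM, mul_pow, mul_pow, hεs, hcs, hPs]
    field_simp
  have hlt : ε ^ α * ∏ i, a i ^ (s - β i) < c * (2 * M) ^ s := by
    rw [← hcM]
    have : M < 2 * M := by linarith
    gcongr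
  calc volume ({x | x ∈ D ∧ |F x| ≤ ε} ∩ {x | ∀ i, x i ∈ A i})
      ≤ volume {x | x ∈ D ∧ (∀ i, x i ∈ A' i) ∧ |F x| ≤ ε ∧
          ε ^ α * ∏ i, a i ^ (s - β i) < |G x| * (2 * M) ^ s} := by
        refine measure_mono ?_
        rintro x ⟨⟨hxD, hxF⟩, hxA⟩
        refine ⟨hxD, fun i => hmem x hxD i (hxA i), hxF, hlt.trans_le ?_⟩
        exact mul_le_mul_of_nonneg_right (hcG x hxD) (by positivity)
    _ ≤ ENNReal.ofReal (C * (2 * M)) := hbound ε hε A' a hA' ha haA (2 * M) (by positivity)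
    _ = ENNReal.ofReal (2 * C * ε ^ ((α : ℝ) / s) * c ^ (-(1 : ℝ) / s)) *
          ∏ i, ENNReal.ofReal (a i ^ (1 - (β i : ℝ) / s)) := by
        rw [← ENNReal.ofReal_prod_of_nonneg fun i _ => (Real.rpow_pos_of_pos (ha i) _).le,
          ← ENNReal.ofReal_mul (by positivity)]
        congr 1
        rw [hM, hP]
        ring
    _ ≤ _ := by
        gcongr with i
        calc ENNReal.ofReal (a i ^ (1 - (β i : ℝ) / s))
            = strictPow (1 - (β i : ℝ) / s) (volume (A' i)) := by
              rw [strictPow, if_neg (hz i), haA i, ENNReal.ofReal_rpow_of_pos (ha i)]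
          _ ≤ _ := strictPow_mono (hρ i) (measure_mono Set.inter_subset_left)

end Assembly

end SublevelEstimate

/-- Improved Phong–Stein–Sturm multilinear sublevel set estimate (Theorem 3 of the paper):
here `1/p_i = 1 - β_i/(|β|+1-α)`. -/
theorem multilinear_sublevel_estimate_admissible
    (d : ℕ) (U : Set (Fin d → ℝ)) (hUopen : IsOpen U) (hUconn : IsConnected U)
    (F : (Fin d → ℝ) → ℝ) (hF : AnalyticOnNhd ℝ F U)
    (D : Set (Fin d → ℝ)) (hDcompact : IsCompact D) (hD : D ⊆ U)
    (α : ℕ) (β : Fin d → ℕ) (L : ((Fin d → ℝ) → ℝ) → (Fin d → ℝ) → ℝ)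
    (hL : IsAdmissible d α β L) (hne : ¬(α = 1 ∧ β = 0)) :
    ∃ C : ℝ, ∀ c : ℝ, 0 < c → (∀ x ∈ D, c ≤ |L F x|) → ∀ ε : ℝ, 0 < ε →
      ∀ f : Fin d → ℝ → ℝ, (∀ i, Measurable (f i)) →
        ENNReal.ofReal |∫ x in {x ∈ D | |F x| ≤ ε}, ∏ i, f i (x i)| ≤
          ENNReal.ofReal
            (C * ε ^ ((α : ℝ) / (((∑ i, β i : ℕ) : ℝ) + 1 - (α : ℝ))) *
              c ^ (-(1 : ℝ) / (((∑ i, β i : ℕ) : ℝ) + 1 - (α : ℝ)))) *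
          ∏ i, lorentzNorm₁
            (1 - (β i : ℝ) / (((∑ i, β i : ℕ) : ℝ) + 1 - (α : ℝ))) (f i) := by
  obtain ⟨s, hsα, hβ, hs, hbound⟩ :=
    SublevelEstimate.exists_hasSublevelBound hUopen hF hDcompact hD hL
  replace hs := hs.resolve_left hne
  have hcast : ((∑ i, β i : ℕ) : ℝ) + 1 - (α : ℝ) = s := by
    rw [sub_eq_iff_eq_add]
    exact_mod_cast hsα.symm
  rw [hcast]
  have hρ : ∀ i, 0 ≤ 1 - (β i : ℝ) / s := fun i => by
    rw [sub_nonneg, div_le_one (by exact_mod_cast hs)]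
    exact_mod_cast hβ i
  obtain ⟨K, hK⟩ := SublevelEstimate.volume_sublevel_inter_box_le hDcompact hs hβ hbound
  refine ⟨K, fun c hc hcL ε hε f hf => ?_⟩
  rw [← Real.enorm_eq_ofReal_abs]
  refine (enorm_integral_le_lintegral_enorm _).trans ?_
  simp only [enorm_eq_nnnorm, nnnorm_prod, ENNReal.ofNNReal_finsetProd]
  exact SublevelEstimate.lintegral_prod_le_of_box hρ (hK c hc hcL ε hε) hf
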